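/- arXiv:2411.16377 — 4 statements merged into one kernel-verified Lean document; each statement's English description precedes it below -/
import Mathlib

section
/- Let n ≥ 2, p > 1, and let Ω ⊂ ℝⁿ be a bounded open set with connected boundary of class C². Let u₁, u₂ ∈ C¹(cl Ω) be two positive first eigenfunctions, i.e. for i = 1,2: uᵢ > 0 in Ω, uᵢ = 0 on ∂Ω, and for every φ ∈ C_c^∞(Ω), ∫_Ω ‖∇uᵢ‖^{p-2} ⟨∇uᵢ, ∇φ⟩ dγ = λ_{p,γ}(Ω) ∫_Ω uᵢ^{p-1} φ dγ. Then there exists a constant b > 0 such that u₁ = b·u₂ on cl Ω. -/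
open MeasureTheory Real Set Metric Bornology
open scoped RealInnerProductSpace Pointwise NNReal Topology

noncomputable def gaussianMeasure (n : ℕ) : Measure (EuclideanSpace ℝ (Fin n)) :=
  (volume : Measure (EuclideanSpace ℝ (Fin n))).withDensity
    (fun x => ENNReal.ofReal ((2 * π) ^ (-(n : ℝ) / 2) * Real.exp (-‖x‖ ^ 2 / 2)))

/-- `φ` is a smooth compactly supported test function on `Ω`. -/
def IsTestFun (n : ℕ) (Ω : Set (EuclideanSpace ℝ (Fin n)))
    (φ : EuclideanSpace ℝ (Fin n) → ℝ) : Prop :=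
  ContDiff ℝ (⊤ : ℕ∞) φ ∧ HasCompactSupport φ ∧ tsupport φ ⊆ Ω

/-- The first eigenvalue of the Gaussian-weighted `p`-Laplacian on `Ω`. -/
noncomputable def lambdaPGamma (n : ℕ) (p : ℝ) (Ω : Set (EuclideanSpace ℝ (Fin n))) : ℝ :=
  sInf { r : ℝ | ∃ v : EuclideanSpace ℝ (Fin n) → ℝ, IsTestFun n Ω v ∧ v ≠ 0 ∧
    r = (∫ x in Ω, ‖gradient v x‖ ^ p ∂(gaussianMeasure n)) /
        (∫ x in Ω, |v x| ^ p ∂(gaussianMeasure n)) }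

/-- `Ω` has boundary of class `C²`. -/
def HasC2Boundary (n : ℕ) (Ω : Set (EuclideanSpace ℝ (Fin n))) : Prop :=
  ∀ x ∈ frontier Ω, ∃ (U : Set (EuclideanSpace ℝ (Fin n))) (f : EuclideanSpace ℝ (Fin n) → ℝ),
    IsOpen U ∧ x ∈ U ∧ ContDiff ℝ 2 f ∧ (∀ y ∈ U, (y ∈ Ω ↔ f y < 0)) ∧
    (∀ y ∈ U, y ∈ frontier Ω → fderiv ℝ f y ≠ 0)


open Filter in
lemma picone_young {p : ℝ} (hp : 1 < p) {x y : ℝ} (hx : 0 ≤ x) (hy : 0 ≤ y) :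
    0 ≤ y ^ p + (p - 1) * x ^ p - p * x ^ (p - 1) * y ∧
    (y ^ p + (p - 1) * x ^ p - p * x ^ (p - 1) * y = 0 → x = y) := by
  rcases hx.eq_or_lt with rfl | hx
  · rw [Real.zero_rpow (by linarith), Real.zero_rpow (by linarith)]
    refine ⟨by simpa using Real.rpow_nonneg hy p, fun h => ?_⟩
    have : y ^ p = 0 := by simpa using h
    exact ((Real.rpow_eq_zero hy (by linarith)).1 this).symm
  · have key : y ^ p + (p - 1) * x ^ p - p * x ^ (p - 1) * y
        = x ^ p * ((1 + (y / x - 1)) ^ p - (1 + p * (y / x - 1))) := by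
      have h1 : x ^ (p - 1) = x ^ p / x := by rw [Real.rpow_sub hx, Real.rpow_one]
      have h2 : (1 + (y / x - 1)) ^ p = y ^ p / x ^ p := by
        rw [← Real.div_rpow hy hx.le]; congr 1; ring
      rw [h1, h2]
      have := (Real.rpow_pos_of_pos hx p).ne'
      field_simp
      ring
    have hxp := Real.rpow_pos_of_pos hx p
    have hs : -1 ≤ y / x - 1 := by have := div_nonneg hy hx.le; linarith
    rw [key]
    refine ⟨mul_nonneg hxp.le (sub_nonneg.2 (one_add_mul_self_le_rpow_one_add hs hp.le)), fun h => ?_⟩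
    by_contra hne
    have hs' : y / x - 1 ≠ 0 := by
      intro h0
      apply hne
      have : y / x = 1 := by linarith
      field_simp at this
      exact this.symm
    have := one_add_mul_self_lt_rpow_one_add hs hs' hp
    have := mul_pos hxp (sub_pos.2 this)
    linarith

lemma picone_vec {E : Type*} [NormedAddCommGroup E] [InnerProductSpace ℝ E] {p : ℝ} (hp : 1 < p)
    (a b : E) {s : ℝ} (hs : 0 < s) :
    0 ≤ ‖b‖ ^ p + (p - 1) * s ^ p * ‖a‖ ^ p - p * s ^ (p - 1) * (‖a‖ ^ (p - 2) * ⟪a, b⟫) ∧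
    (‖b‖ ^ p + (p - 1) * s ^ p * ‖a‖ ^ p - p * s ^ (p - 1) * (‖a‖ ^ (p - 2) * ⟪a, b⟫) = 0 →
      b = s • a) := by
  rcases eq_or_ne a 0 with rfl | ha
  · simp only [norm_zero, inner_zero_left, mul_zero, sub_zero, smul_zero]
    rw [Real.zero_rpow (by linarith)]
    refine ⟨by simpa using Real.rpow_nonneg (norm_nonneg b) p, fun h => ?_⟩
    have : ‖b‖ ^ p = 0 := by simpa using h
    exact norm_eq_zero.1 ((Real.rpow_eq_zero (norm_nonneg _) (by linarith)).1 this)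
  · have ha' : 0 < ‖a‖ := norm_pos_iff.2 ha
    have hx : 0 < s * ‖a‖ := mul_pos hs ha'
    obtain ⟨h1, h2⟩ := picone_young hp hx.le (norm_nonneg b)
    have e1 : (s * ‖a‖) ^ p = s ^ p * ‖a‖ ^ p := Real.mul_rpow hs.le ha'.le
    have e2 : (s * ‖a‖) ^ (p - 1) = s ^ (p - 1) * (‖a‖ ^ (p - 2) * ‖a‖) := by
      rw [Real.mul_rpow hs.le ha'.le]
      congr 1
      rw [← Real.rpow_add_one ha'.ne']; congr 1; ring
    rw [e1, e2] at h1 h2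
    have cs := real_inner_le_norm a b
    have hc : 0 < p * s ^ (p - 1) * ‖a‖ ^ (p - 2) := by positivity
    have hd := mul_nonneg hc.le (sub_nonneg.2 cs)
    refine ⟨by nlinarith, fun h => ?_⟩
    have hin : p * s ^ (p - 1) * ‖a‖ ^ (p - 2) * (‖a‖ * ‖b‖ - ⟪a, b⟫) = 0 := by nlinarith
    have hin' : ⟪a, b⟫ = ‖a‖ * ‖b‖ := by
      rcases mul_eq_zero.1 hin with h | h
      · exact absurd h hc.ne'
      · linarith
    have hn : s * ‖a‖ = ‖b‖ := h2 (by nlinarith)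
    have := (inner_eq_norm_mul_iff_real (x := a) (y := b)).1 hin'
    rw [← hn] at this
    have h3 : ‖a‖ • b = ‖a‖ • (s • a) := by rw [← this, smul_smul]; congr 1; ring
    exact smul_right_injective E ha'.ne' h3

lemma continuous_pfield {E : Type*} [NormedAddCommGroup E] [InnerProductSpace ℝ E] {p : ℝ}
    (hp : 1 < p) : Continuous (fun a : E => ‖a‖ ^ (p - 2) • a) := by
  rw [continuous_iff_continuousAt]
  intro a
  rcases eq_or_ne a 0 with rfl | ha
  · rw [ContinuousAt, smul_zero, tendsto_zero_iff_norm_tendsto_zero]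
    have : (fun a : E => ‖‖a‖ ^ (p - 2) • a‖) = fun a => ‖a‖ ^ (p - 1) := by
      ext a
      rw [norm_smul, Real.norm_of_nonneg (by positivity)]
      rcases eq_or_ne a 0 with rfl | ha
      · rw [norm_zero, mul_zero, Real.zero_rpow (by linarith)]
      · rw [← Real.rpow_add_one (norm_ne_zero_iff.2 ha)]; congr 1; ring
    rw [this]
    have hc : Continuous (fun a : E => ‖a‖ ^ (p - 1)) :=
      continuous_norm.rpow_const (fun _ => Or.inr (by linarith))
    have := hc.tendsto 0
    rwa [norm_zero, Real.zero_rpow (by linarith)] at this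
  · exact (continuous_norm.continuousAt.rpow_const (Or.inl (norm_ne_zero_iff.2 ha))).smul
      continuousAt_id

open Function in
lemma mollify {E : Type*} [NormedAddCommGroup E] [InnerProductSpace ℝ E] [FiniteDimensional ℝ E]
    [MeasurableSpace E] [BorelSpace E] {Ω : Set E} (hΩ : IsOpen Ω) {φ : E → ℝ}
    (hφ : ContDiff ℝ 1 φ) {K : Set E} (hK : IsCompact K) (hKΩ : K ⊆ Ω) (hφK : ∀ x ∉ K, φ x = 0) :
    ∃ K', IsCompact K' ∧ K' ⊆ Ω ∧ K ⊆ K' ∧ ∀ ε > 0, ∃ ψ : E → ℝ, ContDiff ℝ (⊤ : ℕ∞) ψ ∧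
      tsupport ψ ⊆ K' ∧ (∀ x, |ψ x - φ x| ≤ ε) ∧ ∀ x, ‖gradient ψ x - gradient φ x‖ ≤ ε := by
  obtain ⟨δ, hδ, hδΩ⟩ := hK.exists_cthickening_subset_open hΩ hKΩ
  refine ⟨cthickening δ K, hK.cthickening, hδΩ, self_subset_cthickening K, fun ε hε => ?_⟩
  have hcs : HasCompactSupport φ := HasCompactSupport.intro hK hφK
  have uc1 : UniformContinuous φ := hcs.uniformContinuous_of_continuous hφ.continuous
  have hc2 : Continuous (fderiv ℝ φ) := hφ.continuous_fderiv (by norm_num)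
  have uc2 : UniformContinuous (fderiv ℝ φ) :=
    (hcs.fderiv ℝ).uniformContinuous_of_continuous hc2
  obtain ⟨r1, hr1, H1⟩ := Metric.uniformContinuous_iff.1 uc1 ε hε
  obtain ⟨r2, hr2, H2⟩ := Metric.uniformContinuous_iff.1 uc2 ε hε
  set r := min δ (min r1 r2) with hr
  have hr0 : 0 < r := by positivity
  let b : ContDiffBump (0 : E) := ⟨r / 2, r, by linarith, by linarith⟩
  have hli : LocallyIntegrable φ volume := hφ.continuous.locallyIntegrable
  have hlb : LocallyIntegrable (b.normed volume) volume :=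
    (b.continuous_normed).locallyIntegrable
  refine ⟨convolution (b.normed volume) φ (ContinuousLinearMap.lsmul ℝ ℝ) volume, ?_, ?_, ?_, ?_⟩
  · exact b.hasCompactSupport_normed.contDiff_convolution_left _ b.contDiff_normed hli
  · refine closure_minimal ?_ isClosed_cthickening
    refine (support_convolution_subset _).trans ?_
    rintro _ ⟨x, hx, y, hy, rfl⟩
    rw [b.support_normed_eq] at hx
    have hyK : y ∈ K := by by_contra h; exact hy (hφK y h)
    refine mem_cthickening_of_dist_le _ y _ _ hyK ?_
    have : ‖x‖ < r := by simpa using hx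
    simp only [dist_eq_norm, add_sub_cancel_right]
    exact this.le.trans (min_le_left _ _)
  · intro x
    have := b.dist_normed_convolution_le (μ := volume) (g := φ) (x₀ := x) (ε := ε)
      hφ.continuous.aestronglyMeasurable (fun y hy => (H1 (lt_of_lt_of_le hy
        ((min_le_right _ _).trans (min_le_left _ _)))).le)
    rwa [Real.dist_eq] at this
  · intro x
    have := b.dist_normed_convolution_le (μ := volume) (g := fderiv ℝ φ) (x₀ := x) (ε := ε)
      hc2.aestronglyMeasurable (fun y hy => (H2 (lt_of_lt_of_le hy
        ((min_le_right _ _).trans (min_le_right _ _)))).le)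
    have hd := (hcs.hasFDerivAt_convolution_right (ContinuousLinearMap.lsmul ℝ ℝ) hlb hφ x).fderiv
    have he : convolution (b.normed volume) (fderiv ℝ φ)
       ((ContinuousLinearMap.lsmul ℝ ℝ).precompR E) volume x
       = convolution (b.normed volume) (fderiv ℝ φ) (ContinuousLinearMap.lsmul ℝ ℝ) volume x := by
      unfold convolution
      congr 1
    unfold gradient
    rw [← map_sub, LinearIsometryEquiv.norm_map, hd, he, ← dist_eq_norm]
    exact this

/-- The weak equation extends to `C¹` test functions. -/
lemma weak_ext {E : Type*} [NormedAddCommGroup E] [InnerProductSpace ℝ E] [FiniteDimensional ℝ E]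
    [MeasurableSpace E] [BorelSpace E] (μ : Measure E) [IsLocallyFiniteMeasure μ] {Ω : Set E}
    (hΩ : IsOpen Ω) (F : E → E) (h : E → ℝ) (hF : ContinuousOn F Ω) (hh : ContinuousOn h Ω)
    (l : ℝ) (H : ∀ ψ : E → ℝ, ContDiff ℝ (⊤ : ℕ∞) ψ → HasCompactSupport ψ → tsupport ψ ⊆ Ω →
      ∫ x in Ω, ⟪F x, gradient ψ x⟫ ∂μ = l * ∫ x in Ω, h x * ψ x ∂μ)
    {φ : E → ℝ} (hφ : ContDiff ℝ 1 φ) {K : Set E} (hK : IsCompact K) (hKΩ : K ⊆ Ω)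
    (hφK : ∀ x ∉ K, φ x = 0) :
    ∫ x in Ω, ⟪F x, gradient φ x⟫ ∂μ = l * ∫ x in Ω, h x * φ x ∂μ := by
  obtain ⟨K', hK', hK'Ω, hKK', hm⟩ := mollify hΩ hφ hK hKΩ hφK
  choose ψ h1 h2 h3 h4 using fun k : ℕ => hm (1 / ((k : ℝ) + 1)) (by positivity)
  have hlim : Filter.Tendsto (fun k : ℕ => 1 / ((k : ℝ) + 1)) Filter.atTop (𝓝 0) :=
    tendsto_one_div_add_atTop_nhds_zero_nat
  have hgc : ∀ f : E → ℝ, ContDiff ℝ 1 f → Continuous (gradient f) := fun f hf =>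
    (InnerProductSpace.toDual ℝ E).symm.continuous.comp (hf.continuous_fderiv (by norm_num))
  have hψ1 : ∀ k, ContDiff ℝ 1 (ψ k) := fun k => (h1 k).of_le (by exact_mod_cast le_top)
  obtain ⟨CF, hCF⟩ := hK'.exists_bound_of_continuousOn (hF.mono hK'Ω)
  obtain ⟨Ch, hCh⟩ := hK'.exists_bound_of_continuousOn (hh.mono hK'Ω)
  obtain ⟨C1, hC1⟩ := hK'.exists_bound_of_continuousOn (f := φ) hφ.continuous.continuousOn
  obtain ⟨C2, hC2⟩ := hK'.exists_bound_of_continuousOn (f := gradient φ) (hgc φ hφ).continuousOn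
  have hz : ∀ k, ∀ x ∉ K', ψ k x = 0 := fun k x hx => image_eq_zero_of_notMem_tsupport
    (fun h => hx (h2 k h))
  have hz' : ∀ k, ∀ x ∉ K', gradient (ψ k) x = 0 := fun k x hx => by
    have : fderiv ℝ (ψ k) x = 0 := by
      by_contra hne
      exact hx (h2 k (support_fderiv_subset ℝ hne))
    simp [gradient, this]
  have hle1 : ∀ k : ℕ, 1 / ((k : ℝ) + 1) ≤ 1 := fun k => by
    rw [div_le_one (by positivity)]; linarith [(Nat.cast_nonneg k : (0 : ℝ) ≤ k)]
  have hint : ∀ C : ℝ, Integrable (K'.indicator (fun _ => C)) (μ.restrict Ω) := fun C => by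
    rw [integrable_indicator_iff hK'.measurableSet]
    refine integrableOn_const ?_
    exact ((Measure.restrict_apply_le _ _).trans_lt hK'.measure_lt_top).ne
  have t1 : Filter.Tendsto (fun k => ∫ x in Ω, ⟪F x, gradient (ψ k) x⟫ ∂μ) Filter.atTop
      (𝓝 (∫ x in Ω, ⟪F x, gradient φ x⟫ ∂μ)) := by
    refine tendsto_integral_of_dominated_convergence
      (K'.indicator (fun _ => CF * (C2 + 1))) ?_ (hint _) ?_ ?_
    · intro k
      exact (hF.inner (hgc _ (hψ1 k)).continuousOn).aestronglyMeasurable hΩ.measurableSet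
    · intro k
      refine Filter.Eventually.of_forall fun x => ?_
      by_cases hx : x ∈ K'
      · rw [indicator_of_mem hx]
        refine (norm_inner_le_norm _ _).trans ?_
        have a1 := hCF x hx
        have a2 : ‖gradient (ψ k) x‖ ≤ C2 + 1 := by
          have := norm_sub_norm_le (gradient (ψ k) x) (gradient φ x)
          linarith [h4 k x, hle1 k, hC2 x hx]
        exact mul_le_mul a1 a2 (norm_nonneg _) ((norm_nonneg _).trans a1)
      · rw [indicator_of_notMem hx, hz' k x hx]; simp
    · refine Filter.Eventually.of_forall fun x => ?_
      have : Filter.Tendsto (fun k => gradient (ψ k) x) Filter.atTop (𝓝 (gradient φ x)) := by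
        rw [tendsto_iff_norm_sub_tendsto_zero]
        exact squeeze_zero (fun _ => norm_nonneg _) (fun k => h4 k x) hlim
      exact tendsto_const_nhds.inner this
  have t2 : Filter.Tendsto (fun k => l * ∫ x in Ω, h x * ψ k x ∂μ) Filter.atTop
      (𝓝 (l * ∫ x in Ω, h x * φ x ∂μ)) := by
    refine Filter.Tendsto.const_mul _ (tendsto_integral_of_dominated_convergence
      (K'.indicator (fun _ => Ch * (C1 + 1))) ?_ (hint _) ?_ ?_)
    · intro k
      exact (hh.mul (hψ1 k).continuous.continuousOn).aestronglyMeasurable hΩ.measurableSet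
    · intro k
      refine Filter.Eventually.of_forall fun x => ?_
      by_cases hx : x ∈ K'
      · rw [indicator_of_mem hx, norm_mul]
        have a1 := hCh x hx
        have a2 : ‖ψ k x‖ ≤ C1 + 1 := by
          have := norm_sub_norm_le (ψ k x) (φ x)
          have h5 := h3 k x
          rw [← Real.norm_eq_abs] at h5
          linarith [hle1 k, hC1 x hx]
        exact mul_le_mul a1 a2 (norm_nonneg _) ((norm_nonneg _).trans a1)
      · rw [indicator_of_notMem hx, hz k x hx]; simp
    · refine Filter.Eventually.of_forall fun x => ?_
      have : Filter.Tendsto (fun k => ψ k x) Filter.atTop (𝓝 (φ x)) := by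
        rw [tendsto_iff_norm_sub_tendsto_zero]
        exact squeeze_zero (fun _ => norm_nonneg _) (fun k => h3 k x) hlim
      exact tendsto_const_nhds.mul this
  refine tendsto_nhds_unique t1 (t2.congr fun k => ?_)
  exact (H (ψ k) (h1 k) (hK'.of_isClosed_subset (isClosed_tsupport _) (h2 k))
    ((h2 k).trans hK'Ω)).symm

lemma cutoff_prim {ε : ℝ} (hε : 0 < ε) {q : ℝ → ℝ} (hq : Continuous q) (h0 : ∀ t, 0 ≤ q t)
    (h1 : ∀ t, q t ≤ 1) (hz : ∀ t ≤ ε, q t = 0) (ho : ∀ t, 2 * ε ≤ t → q t = 1) :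
    ∃ Q : ℝ → ℝ, (∀ t, HasDerivAt Q (q t) t) ∧ (∀ t ≤ ε, Q t = 0) ∧ (∀ t, 0 ≤ Q t) ∧
      (∀ t, 0 ≤ t → Q t ≤ t) ∧ ∀ t, 0 ≤ t → t - 2 * ε ≤ Q t := by
  have hd : ∀ t, HasDerivAt (fun t => ∫ x in ε..t, q x) (q t) t := fun t =>
    intervalIntegral.integral_hasDerivAt_right (hq.intervalIntegrable _ _)
      (hq.stronglyMeasurableAtFilter _ _) hq.continuousAt
  have hmono : Monotone (fun t => ∫ x in ε..t, q x) :=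
    monotone_of_deriv_nonneg (fun t => (hd t).differentiableAt) (fun t => by
      rw [(hd t).deriv]; exact h0 t)
  have hzero : ∀ t ≤ ε, (∫ x in ε..t, q x) = 0 := fun t ht => by
    rw [intervalIntegral.integral_congr (g := fun _ => 0)]
    · simp
    · intro x hx
      rw [uIcc_of_ge ht] at hx
      exact hz x hx.2
  have hmono2 : Monotone (fun t => t - ∫ x in ε..t, q x) :=
    monotone_of_deriv_nonneg (fun t => ((hasDerivAt_id t).sub (hd t)).differentiableAt) (fun t => by
      have := ((hasDerivAt_id t).sub (hd t)).deriv
      have h' := h1 t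
      change 0 ≤ deriv (id - _) t
      rw [this]; linarith)
  have hnn : ∀ t, 0 ≤ ∫ x in ε..t, q x := fun t => by
    rcases le_total t ε with h | h
    · rw [hzero t h]
    · have := hmono h
      simpa using this
  refine ⟨_, hd, hzero, hnn, ?_, ?_⟩
  · intro t ht
    have := hmono2 ht
    simp only [hzero 0 hε.le] at this
    linarith
  · intro t ht
    rcases le_total t (2 * ε) with h | h
    · linarith [hnn t]
    · have e : (∫ x in ε..t, q x) = (∫ x in ε..(2 * ε), q x) + ∫ x in (2 * ε)..t, q x :=
        (intervalIntegral.integral_add_adjacent_intervals (hq.intervalIntegrable _ _)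
          (hq.intervalIntegrable _ _)).symm
      have e2 : (∫ x in (2 * ε)..t, q x) = t - 2 * ε := by
        rw [intervalIntegral.integral_congr (g := fun _ => 1)]
        · simp
        · intro x hx
          rw [uIcc_of_le h] at hx
          exact ho x hx.1
      show _ ≤ ∫ x in ε..t, q x
      rw [e, e2]
      linarith [hnn (2 * ε)]

lemma cutoff {p : ℝ} (hp : 1 < p) {ε : ℝ} (hε : 0 < ε) : ∃ g G H : ℝ → ℝ, Continuous g ∧
    (∀ t, 0 ≤ g t) ∧ (∀ t, 2 * ε ≤ t → g t = 1) ∧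
    (∀ t ≤ ε, g t = 0) ∧
    (∀ t, HasDerivAt G (g t) t) ∧ (∀ t ≤ ε, G t = 0) ∧ (∀ t, 0 ≤ G t) ∧
      (∀ t, 0 ≤ t → G t ≤ t) ∧ (∀ t, 0 ≤ t → t - 2 * ε ≤ G t) ∧
    (∀ t, HasDerivAt H (g t ^ p) t) ∧ (∀ t ≤ ε, H t = 0) ∧ (∀ t, 0 ≤ H t) ∧
      (∀ t, 0 ≤ t → H t ≤ t) ∧ (∀ t, 0 ≤ t → t - 2 * ε ≤ H t) := by
  let g : ℝ → ℝ := fun t => max 0 (min 1 (t / ε - 1))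
  have hg : Continuous g := by fun_prop
  have h0 : ∀ t, 0 ≤ g t := fun t => le_max_left _ _
  have h1 : ∀ t, g t ≤ 1 := fun t => max_le zero_le_one (min_le_left _ _)
  have hz : ∀ t ≤ ε, g t = 0 := fun t ht => by
    apply max_eq_left
    apply (min_le_right _ _).trans
    have := (div_le_one hε).2 ht
    linarith
  have ho : ∀ t, 2 * ε ≤ t → g t = 1 := fun t ht => by
    have : 2 ≤ t / ε := (le_div_iff₀ hε).2 ht
    have : min 1 (t / ε - 1) = 1 := min_eq_left (by linarith)
    simp only [g, this]; norm_num
  obtain ⟨G, a1, a2, a3, a4, a5⟩ := cutoff_prim hε hg h0 h1 hz ho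
  obtain ⟨H, b1, b2, b3, b4, b5⟩ := cutoff_prim hε (q := fun t => g t ^ p)
    (hg.rpow_const (fun _ => Or.inr (by linarith)))
    (fun t => Real.rpow_nonneg (h0 t) p) (fun t => Real.rpow_le_one (h0 t) (h1 t) (by linarith))
    (fun t ht => by simp only [hz t ht]; exact Real.zero_rpow (by linarith))
    (fun t ht => by simp only [ho t ht]; exact Real.one_rpow _)
  exact ⟨g, G, H, hg, h0, ho, hz, a1, a2, a3, a4, a5, b1, b2, b3, b4, b5⟩

/-- Near a boundary point, `Ω` is connected. -/
lemma local_conn {E : Type*} [NormedAddCommGroup E] [NormedSpace ℝ E] {Ω U : Set E} {f : E → ℝ}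
    {x : E} (hU : IsOpen U) (hxU : x ∈ U) (hf : ContDiff ℝ 1 f)
    (hfU : ∀ y ∈ U, (y ∈ Ω ↔ f y < 0)) (hfx : fderiv ℝ f x ≠ 0) (hx : f x = 0) :
    ∃ V, IsOpen V ∧ x ∈ V ∧ ∀ y ∈ V ∩ Ω, ∀ z ∈ V ∩ Ω, ∃ S, IsPreconnected S ∧ S ⊆ Ω ∧
      y ∈ S ∧ z ∈ S := by
  obtain ⟨e0, he0⟩ : ∃ e, fderiv ℝ f x e ≠ 0 := by
    by_contra h; push Not at h; exact hfx (ContinuousLinearMap.ext h)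
  obtain ⟨e, he⟩ : ∃ e, fderiv ℝ f x e < 0 := by
    rcases he0.lt_or_gt with h | h
    · exact ⟨e0, h⟩
    · exact ⟨-e0, by simpa using h⟩
  have hc : Continuous (fun y => fderiv ℝ f y e) :=
    (hf.continuous_fderiv (by norm_num)).clm_apply continuous_const
  have hop : IsOpen (U ∩ {y | fderiv ℝ f y e < 0}) := hU.inter (isOpen_lt hc continuous_const)
  obtain ⟨r, hr, hball⟩ := Metric.isOpen_iff.1 hop x ⟨hxU, he⟩
  -- choose the length
  set T : ℝ := r / (2 * (‖e‖ + 1)) with hT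
  have hT0 : 0 < T := by positivity
  have hTe : T * ‖e‖ < r / 2 := by
    rw [hT, div_mul_eq_mul_div, div_lt_div_iff₀ (by positivity) (by positivity)]
    nlinarith [norm_nonneg e]
  have hseg : ∀ y ∈ ball x (r / 2), ∀ t ∈ Icc (0 : ℝ) T, y + t • e ∈ ball x r := by
    intro y hy t ht
    rw [mem_ball, dist_eq_norm] at hy ⊢
    have : y + t • e - x = (y - x) + t • e := by abel
    rw [this]
    refine (norm_add_le _ _).trans_lt ?_
    rw [norm_smul, Real.norm_of_nonneg ht.1]
    have := mul_le_mul_of_nonneg_right ht.2 (norm_nonneg e)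
    linarith
  have hder : ∀ y t, HasDerivAt (fun t : ℝ => f (y + t • e)) (fderiv ℝ f (y + t • e) e) t := by
    intro y t
    have h1 : HasDerivAt (fun t : ℝ => y + t • e) e t := by
      simpa using ((hasDerivAt_id t).smul_const e).const_add y
    exact ((hf.differentiable (by norm_num)) _).hasFDerivAt.comp_hasDerivAt t h1
  have hanti : ∀ y ∈ ball x (r / 2), StrictAntiOn (fun t : ℝ => f (y + t • e)) (Icc 0 T) := by
    intro y hy
    refine strictAntiOn_of_deriv_neg (convex_Icc 0 T)
      (fun t _ => (hder y t).continuousAt.continuousWithinAt) fun t ht => ?_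
    rw [interior_Icc] at ht
    rw [(hder y t).deriv]
    exact (hball (hseg y hy t ⟨ht.1.le, ht.2.le⟩)).2
  have hxT : f (x + T • e) < 0 := by
    have := hanti x (mem_ball_self (by linarith)) ⟨le_rfl, hT0.le⟩ ⟨hT0.le, le_rfl⟩ hT0
    simpa [hx] using this
  have hopT : IsOpen {y | f y < 0} := isOpen_lt hf.continuous continuous_const
  obtain ⟨d, hd, hdball⟩ := Metric.isOpen_iff.1 hopT _ hxT
  have hmain : ∀ y ∈ ball x (min d (r / 2)), y ∈ Ω → ∀ t ∈ Icc (0 : ℝ) T, y + t • e ∈ Ω := by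
    intro y hy hyΩ t ht
    have hy2 : y ∈ ball x (r / 2) := ball_subset_ball (min_le_right _ _) hy
    rw [hfU _ (hball (hseg y hy2 t ht)).1]
    have h0 : f y < 0 := (hfU y (hball (ball_subset_ball (by linarith) hy2)).1).1 hyΩ
    have := (hanti y hy2).antitoneOn ⟨le_rfl, hT0.le⟩ ht ht.1
    simp only [zero_smul, add_zero] at this
    linarith
  set B : Set E := (fun y => y + T • e) '' ball x (min d (r / 2)) with hB
  have hBc : IsPreconnected B :=
    (convex_ball x _).isPreconnected.image _ (by fun_prop)
  have hBΩ : B ⊆ Ω := by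
    rintro _ ⟨y, hy, rfl⟩
    have hy2 : y ∈ ball x (r / 2) := ball_subset_ball (min_le_right _ _) hy
    simp only
    rw [hfU _ (hball (hseg y hy2 T ⟨hT0.le, le_rfl⟩)).1]
    apply hdball
    have : dist y x < d := lt_of_lt_of_le hy (min_le_left _ _)
    rwa [mem_ball, dist_add_right]
  refine ⟨ball x (min d (r / 2)), isOpen_ball, mem_ball_self (by positivity), ?_⟩
  rintro y ⟨hyV, hyΩ⟩ z ⟨hzV, hzΩ⟩
  have hS : ∀ y, IsPreconnected ((fun t : ℝ => y + t • e) '' Icc 0 T) := fun y =>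
    isPreconnected_Icc.image _ (by fun_prop)
  have hm0 : ∀ y : E, y ∈ (fun t : ℝ => y + t • e) '' Icc 0 T := fun y =>
    ⟨0, ⟨le_rfl, hT0.le⟩, by simp⟩
  have hm1 : ∀ y : E, y + T • e ∈ (fun t : ℝ => y + t • e) '' Icc 0 T := fun y =>
    ⟨T, ⟨hT0.le, le_rfl⟩, rfl⟩
  refine ⟨((fun t : ℝ => y + t • e) '' Icc 0 T ∪ B) ∪ (fun t : ℝ => z + t • e) '' Icc 0 T,
    ?_, ?_, Or.inl (Or.inl (hm0 y)), Or.inr (hm0 z)⟩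
  · refine IsPreconnected.union (z + T • e) (Or.inr ⟨z, hzV, rfl⟩) (hm1 z) ?_ (hS z)
    exact IsPreconnected.union (y + T • e) (hm1 y) ⟨y, hyV, rfl⟩ (hS y) hBc
  · rintro w ((⟨t, ht, rfl⟩ | hw) | ⟨t, ht, rfl⟩)
    · exact hmain y hyV hyΩ t ht
    · exact hBΩ hw
    · exact hmain z hzV hzΩ t ht

lemma frontier_nonempty_of_open_bdd {E : Type*} [NormedAddCommGroup E] [NormedSpace ℝ E]
    [Nontrivial E] {A : Set E} (hb : IsBounded A) (hne : A.Nonempty) :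
    (frontier A).Nonempty := by
  rw [nonempty_frontier_iff]
  refine ⟨hne, fun h => ?_⟩
  rw [h] at hb
  exact NormedSpace.unbounded_univ ℝ E hb

lemma omega_conn {E : Type*} [NormedAddCommGroup E] [NormedSpace ℝ E] [Nontrivial E] {Ω : Set E}
    (ho : IsOpen Ω) (hb : IsBounded Ω) (hc : IsConnected (frontier Ω))
    (hloc : ∀ x ∈ frontier Ω, ∃ V, IsOpen V ∧ x ∈ V ∧ ∀ y ∈ V ∩ Ω, ∀ z ∈ V ∩ Ω,
      ∃ S, IsPreconnected S ∧ S ⊆ Ω ∧ y ∈ S ∧ z ∈ S) : IsPreconnected Ω := by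
  -- component argument
  rintro A B hA hB hAB ⟨a, haΩ, haA⟩ ⟨b, hbΩ, hbB⟩
  by_contra hemp
  rw [not_nonempty_iff_eq_empty] at hemp
  have hdis : ∀ x, x ∈ Ω → x ∈ A → x ∈ B → False := fun x h1 h2 h3 => by
    have : x ∈ Ω ∩ (A ∩ B) := ⟨h1, h2, h3⟩
    rw [hemp] at this; exact this
  have key : ∀ C D : Set E, IsOpen C → IsOpen D → Ω ⊆ C ∪ D →
      (∀ x, x ∈ Ω → x ∈ C → x ∈ D → False) → frontier (Ω ∩ C) ⊆ frontier Ω := by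
    intro C D hC hD hCD hd x hx
    rw [(ho.inter hC).frontier_eq] at hx
    rw [ho.frontier_eq]
    refine ⟨closure_mono inter_subset_left hx.1, fun hxΩ => ?_⟩
    have hxD : x ∈ D := (hCD hxΩ).resolve_left fun h => hx.2 ⟨hxΩ, h⟩
    obtain ⟨y, hyD, hyΩ, hyC⟩ := mem_closure_iff.1 hx.1 D hD hxD
    exact hd y hyΩ hyC hyD
  have kA := key A B hA hB hAB hdis
  have kB := key B A hB hA (by rwa [union_comm]) (fun x h1 h2 h3 => hdis x h1 h3 h2)
  obtain ⟨xa, hxa⟩ := frontier_nonempty_of_open_bdd (hb.subset (inter_subset_left (t := A))) ⟨a, haΩ, haA⟩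
  obtain ⟨xb, hxb⟩ := frontier_nonempty_of_open_bdd (hb.subset (inter_subset_left (t := B))) ⟨b, hbΩ, hbB⟩
  have hcov : frontier Ω ⊆ closure (Ω ∩ A) ∪ closure (Ω ∩ B) := by
    rw [← closure_union, ← inter_union_distrib_left, inter_eq_left.2 hAB]
    exact frontier_subset_closure
  obtain ⟨x, hxF, hxA, hxB⟩ := isPreconnected_closed_iff.1 hc.isPreconnected _ _ isClosed_closure
    isClosed_closure hcov ⟨xa, kA hxa, frontier_subset_closure hxa⟩
    ⟨xb, kB hxb, frontier_subset_closure hxb⟩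
  obtain ⟨V, hV, hxV, hconn⟩ := hloc x hxF
  obtain ⟨y, hyV, hyΩ, hyA⟩ := mem_closure_iff.1 hxA V hV hxV
  obtain ⟨z, hzV, hzΩ, hzB⟩ := mem_closure_iff.1 hxB V hV hxV
  obtain ⟨S, hS, hSΩ, hyS, hzS⟩ := hconn y ⟨hyV, hyΩ⟩ z ⟨hzV, hzΩ⟩
  obtain ⟨w, hwS, hwA, hwB⟩ := hS A B hA hB (hSΩ.trans hAB) ⟨y, hyS, hyA⟩ ⟨z, hzS, hzB⟩
  exact hdis w (hSΩ hwS) hwA hwB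

section core
variable {E : Type*} [NormedAddCommGroup E] [InnerProductSpace ℝ E] [FiniteDimensional ℝ E]
    [MeasurableSpace E] [BorelSpace E]

lemma inner_gradient_eq {f : E → ℝ} (x a : E) : ⟪a, gradient f x⟫ = fderiv ℝ f x a := by
  rw [real_inner_comm, gradient, InnerProductSpace.toDual_symm_apply]

lemma continuousOn_gradient {f : E → ℝ} {Ω : Set E} (hΩ : IsOpen Ω) (hf : ContDiffOn ℝ 1 f Ω) :
    ContinuousOn (gradient f) Ω :=
  (InnerProductSpace.toDual ℝ E).symm.continuous.comp_continuousOn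
    (hf.continuousOn_fderiv_of_isOpen hΩ le_rfl)

lemma gradient_zero_off {f : E → ℝ} {K : Set E} (hK : IsClosed K) (h : ∀ x ∉ K, f x = 0)
    {x : E} (hx : x ∉ K) : gradient f x = 0 := by
  have : f =ᶠ[𝓝 x] fun _ => 0 := by
    filter_upwards [hK.isOpen_compl.mem_nhds hx] with y hy using h y hy
  rw [gradient, this.fderiv_eq]; simp

lemma integ_compact (μ : Measure E) [IsLocallyFiniteMeasure μ] {Ω K : Set E} (hΩ : IsOpen Ω)
    (hK : IsCompact K) (hKΩ : K ⊆ Ω) {f : E → ℝ} (hf : ContinuousOn f Ω)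
    (hz : ∀ x ∈ Ω, x ∉ K → f x = 0) : IntegrableOn f Ω μ :=
  ((hf.mono hKΩ).integrableOn_compact hK).of_forall_sdiff_eq_zero hΩ.measurableSet
    (fun x hx => hz x hx.1 hx.2)

lemma contDiff_indicator {Ω K : Set E} (hΩ : IsOpen Ω) (hK : IsCompact K) (hKΩ : K ⊆ Ω)
    {f : E → ℝ} (hf : ContDiffOn ℝ 1 f Ω) (hz : ∀ x ∈ Ω, x ∉ K → f x = 0) :
    ContDiff ℝ 1 (Ω.indicator f) ∧ (∀ x ∉ K, Ω.indicator f x = 0) ∧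
      ∀ x ∈ Ω, fderiv ℝ (Ω.indicator f) x = fderiv ℝ f x := by
  have hz' : ∀ x ∉ K, Ω.indicator f x = 0 := fun x hx => by
    by_cases h : x ∈ Ω
    · rw [indicator_of_mem h, hz x h hx]
    · exact indicator_of_notMem h f
  have he : ∀ x ∈ Ω, Ω.indicator f =ᶠ[𝓝 x] f := fun x hx => by
    filter_upwards [hΩ.mem_nhds hx] with y hy using indicator_of_mem hy f
  refine ⟨?_, hz', fun x hx => (he x hx).fderiv_eq⟩
  rw [contDiff_iff_contDiffAt]
  intro x
  by_cases h : x ∈ Ω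
  · exact (hf.contDiffAt (hΩ.mem_nhds h)).congr_of_eventuallyEq (he x h)
  · have hx : x ∉ K := fun h' => h (hKΩ h')
    have : Ω.indicator f =ᶠ[𝓝 x] fun _ => 0 := by
      filter_upwards [hK.isClosed.isOpen_compl.mem_nhds hx] with y hy using hz' y hy
    exact contDiffAt_const.congr_of_eventuallyEq this

lemma norm_rpow_sub_two_mul {p : ℝ} (hp : 1 < p) (a : E) :
    ‖a‖ ^ (p - 2) * ‖a‖ ^ 2 = ‖a‖ ^ p := by
  rcases eq_or_ne a 0 with rfl | ha
  · rw [norm_zero, Real.zero_rpow (x := p) (by linarith)]; simp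
  · rw [← Real.rpow_natCast, ← Real.rpow_add (norm_pos_iff.2 ha)]; congr 1; push_cast; ring

/-- The Picone integrand. -/
noncomputable def picR (p : ℝ) (u v : E → ℝ) (g G : ℝ) (x : E) : ℝ :=
  ‖g • gradient v x‖ ^ p + (p - 1) * (G / u x) ^ p * ‖gradient u x‖ ^ p -
    p * (G / u x) ^ (p - 1) * (‖gradient u x‖ ^ (p - 2) * ⟪gradient u x, g • gradient v x⟫)

lemma picR_nonneg {p : ℝ} (hp : 1 < p) (u v : E → ℝ) {g G : ℝ} {x : E} (hu : 0 < u x)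
    (hG : 0 ≤ G) : 0 ≤ picR p u v g G x := by
  unfold picR
  rcases hG.eq_or_lt with rfl | hG
  · rw [zero_div, Real.zero_rpow (by linarith), Real.zero_rpow (by linarith)]
    have : 0 ≤ ‖g • gradient v x‖ ^ p := by positivity
    simpa using this
  · exact (picone_vec hp _ _ (div_pos hG hu)).1

lemma core_step (μ : Measure E) [IsLocallyFiniteMeasure μ] {Ω : Set E} (hΩ : IsOpen Ω)
    (hb : IsBounded Ω) {p : ℝ} (hp : 1 < p) {u v : E → ℝ} (hu : ContDiffOn ℝ 1 u Ω)
    (hv : ContDiffOn ℝ 1 v Ω) (hup : ∀ x ∈ Ω, 0 < u x)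
    (hvc : ContinuousOn v (closure Ω)) (hvb : ∀ x ∈ frontier Ω, v x = 0) (hvp : ∀ x ∈ Ω, 0 < v x)
    (l : ℝ)
    (Hu : ∀ ψ : E → ℝ, ContDiff ℝ (⊤ : ℕ∞) ψ → HasCompactSupport ψ → tsupport ψ ⊆ Ω →
      ∫ x in Ω, ⟪‖gradient u x‖ ^ (p - 2) • gradient u x, gradient ψ x⟫ ∂μ
        = l * ∫ x in Ω, u x ^ (p - 1) * ψ x ∂μ)
    (Hv : ∀ ψ : E → ℝ, ContDiff ℝ (⊤ : ℕ∞) ψ → HasCompactSupport ψ → tsupport ψ ⊆ Ω →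
      ∫ x in Ω, ⟪‖gradient v x‖ ^ (p - 2) • gradient v x, gradient ψ x⟫ ∂μ
        = l * ∫ x in Ω, v x ^ (p - 1) * ψ x ∂μ)
    {ε : ℝ} (hε : 0 < ε) {g G H : ℝ → ℝ} (hg : Continuous g) (hg0 : ∀ t, 0 ≤ g t)
    (hGd : ∀ t, HasDerivAt G (g t) t) (hGz : ∀ t ≤ ε, G t = 0) (hG0 : ∀ t, 0 ≤ G t)
    (hHd : ∀ t, HasDerivAt H (g t ^ p) t) (hHz : ∀ t ≤ ε, H t = 0) :
    AEMeasurable (fun x => picR p u v (g (v x)) (G (v x)) x) (μ.restrict Ω) ∧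
    ∫⁻ x in Ω, ENNReal.ofReal (picR p u v (g (v x)) (G (v x)) x) ∂μ =
      ENNReal.ofReal (l * ∫ x in Ω, (v x ^ (p - 1) * H (v x) - G (v x) ^ p) ∂μ) := by
  set K : Set E := {x ∈ closure Ω | ε ≤ v x} with hKdef
  have hKc : IsCompact K := by
    refine hb.isCompact_closure.of_isClosed_subset ?_ (fun x hx => hx.1)
    exact hvc.preimage_isClosed_of_isClosed isClosed_closure isClosed_Ici
  have hKΩ : K ⊆ Ω := fun x hx => by
    by_contra h
    have : x ∈ frontier Ω := by rw [hΩ.frontier_eq]; exact ⟨hx.1, h⟩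
    have := hvb x this
    linarith [hx.2]
  have hKn : ∀ x ∈ Ω, x ∉ K → v x ≤ ε := fun x hx hxK => by
    by_contra h
    exact hxK ⟨subset_closure hx, (not_le.1 h).le⟩
  have hgp : Continuous (fun t => g t ^ p) := hg.rpow_const fun _ => Or.inr (by linarith)
  have hGC : ContDiff ℝ 1 G := by
    rw [contDiff_one_iff_deriv]
    exact ⟨fun t => (hGd t).differentiableAt, by rw [show deriv G = g from funext fun t => (hGd t).deriv]; exact hg⟩
  have hHC : ContDiff ℝ 1 H := by
    rw [contDiff_one_iff_deriv]
    exact ⟨fun t => (hHd t).differentiableAt, by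
      rw [show deriv H = fun t => g t ^ p from funext fun t => (hHd t).deriv]; exact hgp⟩
  -- the test functions
  have hf1 : ContDiffOn ℝ 1 (fun x => H (v x)) Ω := hHC.comp_contDiffOn hv
  have hGv : ContDiffOn ℝ 1 (fun x => G (v x)) Ω := hGC.comp_contDiffOn hv
  have hGp : ContDiffOn ℝ 1 (fun x => G (v x) ^ p) Ω :=
    hGv.rpow_const_of_le (m := 1) (by simpa using hp.le)
  have hf2 : ContDiffOn ℝ 1 (fun x => G (v x) ^ p * u x ^ (1 - p)) Ω :=
    hGp.mul (hu.rpow_const_of_ne fun x hx => (hup x hx).ne')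
  obtain ⟨c1, z1, d1⟩ := contDiff_indicator hΩ hKc hKΩ hf1 (fun x hx hxK => hHz _ (hKn x hx hxK))
  obtain ⟨c2, z2, d2⟩ := contDiff_indicator hΩ hKc hKΩ hf2 (fun x hx hxK => by
    simp only [hGz _ (hKn x hx hxK)]; rw [Real.zero_rpow (by linarith), zero_mul])
  set φ1 := Ω.indicator (fun x => H (v x)) with hφ1
  set φ2 := Ω.indicator (fun x => G (v x) ^ p * u x ^ (1 - p)) with hφ2
  have hFu : ContinuousOn (fun x => ‖gradient u x‖ ^ (p - 2) • gradient u x) Ω :=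
    (continuous_pfield hp).comp_continuousOn (continuousOn_gradient hΩ hu)
  have hFv : ContinuousOn (fun x => ‖gradient v x‖ ^ (p - 2) • gradient v x) Ω :=
    (continuous_pfield hp).comp_continuousOn (continuousOn_gradient hΩ hv)
  have hup1 : ContinuousOn (fun x => u x ^ (p - 1)) Ω :=
    hu.continuousOn.rpow_const fun _ _ => Or.inr (by linarith)
  have hvp1 : ContinuousOn (fun x => v x ^ (p - 1)) Ω :=
    hv.continuousOn.rpow_const fun _ _ => Or.inr (by linarith)
  have e1 := weak_ext μ hΩ _ _ hFv hvp1 l Hv c1 hKc hKΩ z1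
  have e2 := weak_ext μ hΩ _ _ hFu hup1 l Hu c2 hKc hKΩ z2
  have hI1c : ContinuousOn
      (fun x => ⟪‖gradient v x‖ ^ (p - 2) • gradient v x, gradient φ1 x⟫) Ω :=
    hFv.inner (continuousOn_gradient hΩ c1.contDiffOn)
  have hI2c : ContinuousOn
      (fun x => ⟪‖gradient u x‖ ^ (p - 2) • gradient u x, gradient φ2 x⟫) Ω :=
    hFu.inner (continuousOn_gradient hΩ c2.contDiffOn)
  have hI1 := integ_compact μ hΩ hKc hKΩ hI1c (fun x _ hx => by
    rw [gradient_zero_off hKc.isClosed z1 hx, inner_zero_right])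
  have hI2 := integ_compact μ hΩ hKc hKΩ hI2c (fun x _ hx => by
    rw [gradient_zero_off hKc.isClosed z2 hx, inner_zero_right])
  have hpt : ∀ x ∈ Ω, picR p u v (g (v x)) (G (v x)) x =
      ⟪‖gradient v x‖ ^ (p - 2) • gradient v x, gradient φ1 x⟫ -
      ⟪‖gradient u x‖ ^ (p - 2) • gradient u x, gradient φ2 x⟫ := by
    intro x hx
    have du : HasFDerivAt u (fderiv ℝ u x) x :=
      ((hu.contDiffAt (hΩ.mem_nhds hx)).differentiableAt (by norm_num)).hasFDerivAt
    have dv : HasFDerivAt v (fderiv ℝ v x) x :=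
      ((hv.contDiffAt (hΩ.mem_nhds hx)).differentiableAt (by norm_num)).hasFDerivAt
    have dH : HasFDerivAt (fun x => H (v x)) (g (v x) ^ p • fderiv ℝ v x) x :=
      (hHd (v x)).comp_hasFDerivAt x dv
    have dG : HasFDerivAt (fun x => G (v x)) (g (v x) • fderiv ℝ v x) x :=
      (hGd (v x)).comp_hasFDerivAt x dv
    have dGp := dG.rpow_const (p := p) (Or.inr hp.le)
    have dup := du.rpow_const (p := 1 - p) (Or.inl (hup x hx).ne')
    have dd := dGp.mul dup
    rw [inner_smul_left, inner_smul_left, inner_gradient_eq, inner_gradient_eq, d1 x hx, d2 x hx,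
      dH.fderiv]
    erw [dd.fderiv]
    simp only [ContinuousLinearMap.add_apply, ContinuousLinearMap.smul_apply, smul_eq_mul,
      ← inner_gradient_eq, real_inner_self_eq_norm_sq, conj_trivial]
    unfold picR
    rw [norm_smul, Real.norm_of_nonneg (hg0 _), Real.mul_rpow (hg0 _) (norm_nonneg _),
      inner_smul_right, Real.div_rpow (hG0 _) (hup x hx).le, Real.div_rpow (hG0 _) (hup x hx).le,
      ← norm_rpow_sub_two_mul hp (gradient v x), ← norm_rpow_sub_two_mul hp (gradient u x)]
    have hu0 := hup x hx
    have q1 : u x ^ (1 - p) = (u x ^ (p - 1))⁻¹ := by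
      rw [← Real.rpow_neg hu0.le]; congr 1; ring
    have q2 : u x ^ (1 - p - 1) = (u x ^ p)⁻¹ := by
      rw [← Real.rpow_neg hu0.le]; congr 1; ring
    rw [q1, q2]
    ring
  have hRi : IntegrableOn (fun x => picR p u v (g (v x)) (G (v x)) x) Ω μ :=
    (hI1.sub hI2).congr_fun (fun x hx => (hpt x hx).symm) hΩ.measurableSet
  refine ⟨hRi.aestronglyMeasurable.aemeasurable, ?_⟩
  rw [← ofReal_integral_eq_lintegral_ofReal hRi]
  · congr 1
    rw [setIntegral_congr_fun hΩ.measurableSet hpt, integral_sub hI1 hI2, e1, e2, ← mul_sub]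
    congr 1
    rw [← integral_sub]
    · refine setIntegral_congr_fun hΩ.measurableSet fun x hx => ?_
      simp only [hφ1, hφ2, indicator_of_mem hx]
      have : u x ^ (p - 1) * u x ^ (1 - p) = 1 := by
        rw [← Real.rpow_add (hup x hx)]; simp
      linear_combination (-(G (v x) ^ p)) * this
    · exact integ_compact μ hΩ hKc hKΩ (hvp1.mul c1.continuous.continuousOn) (fun x _ hx => by
        rw [z1 x hx, mul_zero])
    · exact integ_compact μ hΩ hKc hKΩ (hup1.mul c2.continuous.continuousOn) (fun x _ hx => by
        rw [z2 x hx, mul_zero])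
  · filter_upwards [ae_restrict_mem hΩ.measurableSet] with x hx
    exact picR_nonneg hp u v (hup x hx) (hG0 _)

lemma core_all (μ : Measure E) [IsLocallyFiniteMeasure μ] [μ.IsOpenPosMeasure] {Ω : Set E}
    (hΩ : IsOpen Ω)
    (hb : IsBounded Ω) {p : ℝ} (hp : 1 < p) {u v : E → ℝ} (hu : ContDiffOn ℝ 1 u Ω)
    (hv : ContDiffOn ℝ 1 v Ω) (hup : ∀ x ∈ Ω, 0 < u x)
    (hvc : ContinuousOn v (closure Ω)) (hvb : ∀ x ∈ frontier Ω, v x = 0) (hvp : ∀ x ∈ Ω, 0 < v x)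
    (l : ℝ)
    (Hu : ∀ ψ : E → ℝ, ContDiff ℝ (⊤ : ℕ∞) ψ → HasCompactSupport ψ → tsupport ψ ⊆ Ω →
      ∫ x in Ω, ⟪‖gradient u x‖ ^ (p - 2) • gradient u x, gradient ψ x⟫ ∂μ
        = l * ∫ x in Ω, u x ^ (p - 1) * ψ x ∂μ)
    (Hv : ∀ ψ : E → ℝ, ContDiff ℝ (⊤ : ℕ∞) ψ → HasCompactSupport ψ → tsupport ψ ⊆ Ω →
      ∫ x in Ω, ⟪‖gradient v x‖ ^ (p - 2) • gradient v x, gradient ψ x⟫ ∂μ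
        = l * ∫ x in Ω, v x ^ (p - 1) * ψ x ∂μ) :
    ∀ x ∈ Ω, gradient v x = (v x / u x) • gradient u x := by
  choose g G H hg hg0 hg1 hgz hGd hGz hG0 hGle hGge hHd hHz hH0 hHle hHge using
    fun k : ℕ => cutoff hp (ε := 1 / ((k : ℝ) + 1)) (by positivity)
  have hlim : Filter.Tendsto (fun k : ℕ => 1 / ((k : ℝ) + 1)) Filter.atTop (𝓝 0) :=
    tendsto_one_div_add_atTop_nhds_zero_nat
  have hlim2 : Filter.Tendsto (fun k : ℕ => 2 * (1 / ((k : ℝ) + 1))) Filter.atTop (𝓝 0) := by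
    simpa using hlim.const_mul 2
  have hstep := fun k : ℕ => core_step μ hΩ hb hp hu hv hup hvc hvb hvp l Hu Hv
    (ε := 1 / ((k : ℝ) + 1)) (by positivity) (hg k) (hg0 k) (hGd k) (hGz k) (hG0 k) (hHd k) (hHz k)
  have tG : ∀ t, 0 < t → Filter.Tendsto (fun k => G k t) Filter.atTop (𝓝 t) := fun t ht =>
    tendsto_of_tendsto_of_tendsto_of_le_of_le (by simpa using tendsto_const_nhds.sub hlim2)
      tendsto_const_nhds (fun k => hGge k t ht.le) (fun k => hGle k t ht.le)
  have tH : ∀ t, 0 < t → Filter.Tendsto (fun k => H k t) Filter.atTop (𝓝 t) := fun t ht =>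
    tendsto_of_tendsto_of_tendsto_of_le_of_le (by simpa using tendsto_const_nhds.sub hlim2)
      tendsto_const_nhds (fun k => hHge k t ht.le) (fun k => hHle k t ht.le)
  have tg : ∀ t, 0 < t → Filter.Tendsto (fun k => g k t) Filter.atTop (𝓝 1) := fun t ht => by
    refine tendsto_const_nhds.congr' ?_
    filter_upwards [hlim2.eventually (gt_mem_nhds ht)] with k hk
    exact (hg1 k t hk.le).symm
  obtain ⟨M, hM⟩ := hb.isCompact_closure.exists_bound_of_continuousOn hvc
  have hμΩ : μ Ω < ⊤ := hb.measure_lt_top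
  -- right sides tend to zero
  have hrhs : Filter.Tendsto (fun k => ENNReal.ofReal
      (l * ∫ x in Ω, (v x ^ (p - 1) * H k (v x) - G k (v x) ^ p) ∂μ)) Filter.atTop (𝓝 0) := by
    have : Filter.Tendsto (fun k => ∫ x in Ω, (v x ^ (p - 1) * H k (v x) - G k (v x) ^ p) ∂μ)
        Filter.atTop (𝓝 (∫ x in Ω, (0 : ℝ) ∂μ)) := by
      refine tendsto_integral_of_dominated_convergence (fun _ => M ^ p) ?_
        (integrableOn_const hμΩ.ne) ?_ ?_
      · intro k
        have hHc : Continuous (H k) := continuous_iff_continuousAt.2 fun t => (hHd k t).continuousAt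
        have hGc : Continuous (G k) := continuous_iff_continuousAt.2 fun t => (hGd k t).continuousAt
        refine ContinuousOn.aestronglyMeasurable ?_ hΩ.measurableSet
        exact ((hv.continuousOn.rpow_const fun _ _ => Or.inr (by linarith)).mul
          (hHc.comp_continuousOn hv.continuousOn)).sub
          ((hGc.comp_continuousOn hv.continuousOn).rpow_const fun _ _ => Or.inr (by linarith))
      · intro k
        filter_upwards [ae_restrict_mem hΩ.measurableSet] with x hx
        have hx0 := hvp x hx
        have hxM : v x ≤ M := (le_abs_self _).trans (hM x (subset_closure hx))
        have hvM : v x ^ p ≤ M ^ p := Real.rpow_le_rpow hx0.le hxM (by linarith)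
        have i1 : v x ^ (p - 1) * H k (v x) ≤ v x ^ p := by
          have : v x ^ p = v x ^ (p - 1) * v x := by
            rw [← Real.rpow_add_one hx0.ne']; congr 1; ring
          rw [this]
          exact mul_le_mul_of_nonneg_left (hHle k _ hx0.le) (by positivity)
        have i2 : 0 ≤ v x ^ (p - 1) * H k (v x) := mul_nonneg (by positivity) (hH0 k _)
        have i3 : G k (v x) ^ p ≤ v x ^ p :=
          Real.rpow_le_rpow (hG0 k _) (hGle k _ hx0.le) (by linarith)
        have i4 : 0 ≤ G k (v x) ^ p := Real.rpow_nonneg (hG0 k _) _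
        rw [Real.norm_eq_abs, abs_le]
        constructor <;> linarith
      · filter_upwards [ae_restrict_mem hΩ.measurableSet] with x hx
        have hx0 := hvp x hx
        have h1 := ((tH _ hx0).const_mul (v x ^ (p - 1))).sub
          ((tG _ hx0).rpow_const (p := p) (Or.inl hx0.ne'))
        have : v x ^ (p - 1) * v x = v x ^ p := by
            rw [← Real.rpow_add_one hx0.ne']; congr 1; ring
        rwa [this, sub_self] at h1
    have := (this.const_mul l)
    simp only [integral_zero, mul_zero] at this
    simpa using (ENNReal.tendsto_ofReal this)
  have htend : ∀ x ∈ Ω, Filter.Tendsto (fun k => picR p u v (g k (v x)) (G k (v x)) x)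
      Filter.atTop (𝓝 (picR p u v 1 (v x) x)) := by
    intro x hx
    have hx0 := hvp x hx
    have a1 := tg _ hx0
    have a2 := (tG _ hx0).div_const (u x)
    have hs : v x / u x ≠ 0 := (div_pos hx0 (hup x hx)).ne'
    have a3 := a1.smul_const (gradient v x)
    unfold picR
    refine Filter.Tendsto.sub (Filter.Tendsto.add ?_ ?_) ?_
    · exact a3.norm.rpow_const (Or.inr (by linarith))
    · exact ((a2.rpow_const (Or.inl hs)).const_mul _).mul_const _
    · exact ((a2.rpow_const (Or.inl hs)).const_mul _).mul ((tendsto_const_nhds.inner a3).const_mul _)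
  have hzero : ∫⁻ x in Ω, ENNReal.ofReal (picR p u v 1 (v x) x) ∂μ = 0 := by
    rw [← nonpos_iff_eq_zero]
    calc ∫⁻ x in Ω, ENNReal.ofReal (picR p u v 1 (v x) x) ∂μ
        = ∫⁻ x in Ω, Filter.liminf
            (fun k => ENNReal.ofReal (picR p u v (g k (v x)) (G k (v x)) x)) Filter.atTop ∂μ := by
          refine setLIntegral_congr_fun hΩ.measurableSet fun x hx => ?_
          exact (ENNReal.tendsto_ofReal (htend x hx)).liminf_eq.symm
      _ ≤ Filter.liminf (fun k => ∫⁻ x in Ω,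
            ENNReal.ofReal (picR p u v (g k (v x)) (G k (v x)) x) ∂μ) Filter.atTop :=
          lintegral_liminf_le' fun k => (hstep k).1.ennreal_ofReal
      _ = 0 := by
          simp only [fun k => (hstep k).2]
          exact hrhs.liminf_eq
  have hcont : ContinuousOn (fun x => picR p u v 1 (v x) x) Ω := by
    have cu := continuousOn_gradient hΩ hu
    have cv := continuousOn_gradient hΩ hv
    have cs : ContinuousOn (fun x => v x / u x) Ω :=
      hv.continuousOn.div hu.continuousOn fun x hx => (hup x hx).ne'
    have e : ∀ x, ‖gradient u x‖ ^ (p - 2) * ⟪gradient u x, gradient v x⟫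
        = ⟪‖gradient u x‖ ^ (p - 2) • gradient u x, gradient v x⟫ := fun x => by
      rw [inner_smul_left]; rfl
    unfold picR
    simp only [one_smul, e]
    refine ((cv.norm.rpow_const fun _ _ => Or.inr (by linarith)).add
      ((continuousOn_const.mul (cs.rpow_const fun _ _ => Or.inr (by linarith))).mul
        (cu.norm.rpow_const fun _ _ => Or.inr (by linarith)))).sub
      ((continuousOn_const.mul (cs.rpow_const fun _ _ => Or.inr (by linarith))).mul
        (((continuous_pfield hp).comp_continuousOn cu).inner cv))
  have hae : (fun x => picR p u v 1 (v x) x) =ᵐ[μ.restrict Ω] fun _ => 0 := by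
    rw [lintegral_eq_zero_iff' (hcont.aemeasurable hΩ.measurableSet).ennreal_ofReal] at hzero
    filter_upwards [hzero, ae_restrict_mem hΩ.measurableSet] with x hx hxΩ
    have h1 : picR p u v 1 (v x) x ≤ 0 := by simpa using hx
    exact le_antisymm h1 (picR_nonneg hp u v (hup x hxΩ) (hvp x hxΩ).le)
  have hall := Measure.eqOn_open_of_ae_eq hae hΩ hcont continuousOn_const
  intro x hx
  have h0 : picR p u v 1 (v x) x = 0 := hall hx
  unfold picR at h0
  have := (picone_vec hp (gradient u x) ((1 : ℝ) • gradient v x)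
    (div_pos (hvp x hx) (hup x hx))).2 h0
  rwa [one_smul] at this

end core

/-- **Uniqueness of the positive first eigenfunction up to a multiplicative constant**
(part of Theorem 3.1 of the paper): if `Ω ⊂ ℝⁿ` (`n ≥ 2`) is a bounded open set with
connected `C²` boundary and `u₁, u₂` are positive first eigenfunctions of the
Gaussian-weighted `p`-Laplacian, then `u₁ = b u₂` for some constant `b > 0`. -/
theorem first_eigenfunction_unique
    (n : ℕ) (hn : 2 ≤ n) (p : ℝ) (hp : 1 < p)
    (Ω : Set (EuclideanSpace ℝ (Fin n)))
    (hΩo : IsOpen Ω) (hΩb : IsBounded Ω) (hΩ2 : HasC2Boundary n Ω)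
    (hΩbc : IsConnected (frontier Ω))
    (u₁ u₂ : EuclideanSpace ℝ (Fin n) → ℝ)
    (hu₁1 : ContDiffOn ℝ 1 u₁ (closure Ω)) (hu₂1 : ContDiffOn ℝ 1 u₂ (closure Ω))
    (hu₁pos : ∀ x ∈ Ω, 0 < u₁ x) (hu₂pos : ∀ x ∈ Ω, 0 < u₂ x)
    (hu₁b : ∀ x ∈ frontier Ω, u₁ x = 0) (hu₂b : ∀ x ∈ frontier Ω, u₂ x = 0)
    (heig₁ : ∀ φ : EuclideanSpace ℝ (Fin n) → ℝ, IsTestFun n Ω φ →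
      ∫ x in Ω, ‖gradient u₁ x‖ ^ (p - 2) * ⟪gradient u₁ x, gradient φ x⟫ ∂(gaussianMeasure n)
        = lambdaPGamma n p Ω * ∫ x in Ω, u₁ x ^ (p - 1) * φ x ∂(gaussianMeasure n))
    (heig₂ : ∀ φ : EuclideanSpace ℝ (Fin n) → ℝ, IsTestFun n Ω φ →
      ∫ x in Ω, ‖gradient u₂ x‖ ^ (p - 2) * ⟪gradient u₂ x, gradient φ x⟫ ∂(gaussianMeasure n)
        = lambdaPGamma n p Ω * ∫ x in Ω, u₂ x ^ (p - 1) * φ x ∂(gaussianMeasure n)) :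
    ∃ b : ℝ, 0 < b ∧ ∀ x ∈ closure Ω, u₁ x = b * u₂ x := by
  have hnt : Nontrivial (EuclideanSpace ℝ (Fin n)) := by
    have : Nonempty (Fin n) := ⟨⟨0, by omega⟩⟩
    infer_instance
  have hcd : Continuous (fun x : EuclideanSpace ℝ (Fin n) =>
      (2 * π) ^ (-(n : ℝ) / 2) * Real.exp (-‖x‖ ^ 2 / 2)) := by fun_prop
  have hlf : IsLocallyFiniteMeasure (gaussianMeasure n) :=
    IsLocallyFiniteMeasure.withDensity_ofReal hcd
  have hop : (gaussianMeasure n).IsOpenPosMeasure := by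
    refine Measure.AbsolutelyContinuous.isOpenPosMeasure (μ := volume) ?_
    refine withDensity_absolutelyContinuous' hcd.measurable.ennreal_ofReal.aemeasurable ?_
    refine Filter.Eventually.of_forall fun x => ?_
    have : 0 < (2 * π) ^ (-(n : ℝ) / 2) * Real.exp (-‖x‖ ^ 2 / 2) := by positivity
    simpa using this
  have hconn : IsPreconnected Ω := by
    refine omega_conn hΩo hΩb hΩbc fun x hx => ?_
    obtain ⟨U, f, hU, hxU, hf, hfU, hfd⟩ := hΩ2 x hx
    refine local_conn hU hxU (hf.of_le (by norm_num)) hfU (hfd x hxU hx) ?_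
    have hxc := hx
    rw [hΩo.frontier_eq] at hx
    have h1 : 0 ≤ f x := not_lt.1 fun h => hx.2 ((hfU x hxU).2 h)
    refine le_antisymm (not_lt.1 fun h => ?_) h1
    obtain ⟨y, ⟨hyU, hy⟩, hyΩ⟩ := mem_closure_iff.1 hx.1 (U ∩ {y | 0 < f y})
      (hU.inter (isOpen_lt continuous_const hf.continuous)) ⟨hxU, h⟩
    exact absurd ((hfU y hyU).1 hyΩ) (not_lt.2 (le_of_lt hy))
  have hd1 := hu₁1.mono subset_closure
  have hd2 := hu₂1.mono subset_closure
  have hcore := core_all (gaussianMeasure n) hΩo hΩb hp hd2 hd1 hu₂pos hu₁1.continuousOn hu₁b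
    hu₁pos (lambdaPGamma n p Ω)
    (fun ψ a b c => by
      rw [← heig₂ ψ ⟨a, b, c⟩]; simp only [inner_smul_left, conj_trivial])
    (fun ψ a b c => by
      rw [← heig₁ ψ ⟨a, b, c⟩]; simp only [inner_smul_left, conj_trivial])
  have hne : Ω.Nonempty := by
    by_contra h
    rw [not_nonempty_iff_eq_empty] at h
    have := hΩbc.nonempty
    rw [h, frontier_empty] at this
    exact not_nonempty_empty this
  obtain ⟨x0, hx0⟩ := hne
  have hdf1 : ∀ x ∈ Ω, DifferentiableAt ℝ u₁ x := fun x hx =>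
    (hd1.contDiffAt (hΩo.mem_nhds hx)).differentiableAt (by norm_num)
  have hdf2 : ∀ x ∈ Ω, DifferentiableAt ℝ u₂ x := fun x hx =>
    (hd2.contDiffAt (hΩo.mem_nhds hx)).differentiableAt (by norm_num)
  have hquot : ∀ x ∈ Ω, HasFDerivAt (fun x => u₁ x / u₂ x)
      ((u₂ x ^ 2)⁻¹ • (u₂ x • fderiv ℝ u₁ x - u₁ x • fderiv ℝ u₂ x)) x := fun x hx => by
    have h0 := (hu₂pos x hx).ne'
    have hi := (hasDerivAt_inv h0).comp_hasFDerivAt x (hdf2 x hx).hasFDerivAt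
    have hm := (hdf1 x hx).hasFDerivAt.mul hi
    refine HasFDerivAt.congr_fderiv (f := fun x => u₁ x / u₂ x) hm ?_
    ext a
    simp
    field_simp
    ring
  have hconst : ∀ x ∈ Ω, u₁ x / u₂ x = u₁ x0 / u₂ x0 := fun x hx => by
    refine hΩo.is_const_of_fderiv_eq_zero (𝕜 := ℝ) (f := fun x => u₁ x / u₂ x) hconn
      (fun y hy => (hquot y hy).differentiableAt.differentiableWithinAt) (fun y hy => ?_) hx hx0
    rw [(hquot y hy).fderiv]
    ext a
    have h1 := congrArg (fun w => ⟪a, w⟫) (hcore y hy)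
    simp only [inner_smul_right, inner_gradient_eq] at h1
    have := (hu₂pos y hy).ne'
    simp only [ContinuousLinearMap.smul_apply, ContinuousLinearMap.sub_apply, smul_eq_mul, h1,
      Pi.zero_apply, ContinuousLinearMap.zero_apply]
    field_simp
    ring
  refine ⟨u₁ x0 / u₂ x0, div_pos (hu₁pos x0 hx0) (hu₂pos x0 hx0), fun x hx => ?_⟩
  by_cases hxΩ : x ∈ Ω
  · rw [← hconst x hxΩ]
    have := (hu₂pos x hxΩ).ne'
    field_simp
  · have : x ∈ frontier Ω := by rw [hΩo.frontier_eq]; exact ⟨hx, hxΩ⟩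
    rw [hu₁b x this, hu₂b x this, mul_zero]
end

section
/- (Weak comparison principle for the weighted p-Laplacian.) Let n ≥ 2, p > 1, and let Ω ⊂ ℝⁿ be a bounded open set with boundary of class C². Let u₁, u₂ ∈ C¹(cl Ω) satisfy: for every nonnegative φ ∈ C_c^∞(Ω), ∫_Ω ‖∇u₁‖^{p-2} ⟨∇u₁, ∇φ⟩ dγ ≤ ∫_Ω ‖∇u₂‖^{p-2} ⟨∇u₂, ∇φ⟩ dγ. If u₁ ≤ u₂ on ∂Ω, then u₁ ≤ u₂ on all of Ω. -/
open MeasureTheory Real Set Metric Bornology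
open scoped RealInnerProductSpace Pointwise NNReal Topology

section
variable {E : Type*} [NormedAddCommGroup E] [InnerProductSpace ℝ E]

theorem wcp_A_cont (p : ℝ) (hp : 1 < p) : Continuous (fun z : E => ‖z‖ ^ (p - 2) • z) := by
  rw [continuous_iff_continuousAt]
  intro z
  by_cases hz : z = 0
  · subst hz
    change Filter.Tendsto _ _ (𝓝 (‖(0:E)‖ ^ (p - 2) • (0:E)))
    rw [smul_zero]
    apply squeeze_zero_norm (a := fun z : E => ‖z‖ ^ (p - 1))
    · intro t
      rw [norm_smul, Real.norm_of_nonneg (by positivity)]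
      by_cases ht : t = 0
      · subst ht; simp; positivity
      · have h0 : 0 < ‖t‖ := norm_pos_iff.mpr ht
        have : p - 1 = (p - 2) + 1 := by ring
        rw [this, Real.rpow_add_one h0.ne']
    · have : Continuous (fun z : E => ‖z‖ ^ (p - 1)) :=
        continuous_norm.rpow_const (fun _ => Or.inr (by linarith))
      have h := this.tendsto 0
      simpa [Real.zero_rpow (by linarith : p - 1 ≠ 0)] using h
  · have h0 : ‖z‖ ≠ 0 := norm_ne_zero_iff.mpr hz
    exact (continuousAt_id.norm.rpow_const (Or.inl h0)).smul continuousAt_id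

theorem wcp_A_mono (p : ℝ) (hp : 1 < p) (a b : E) (hab : a ≠ b) :
    0 < ⟪‖a‖ ^ (p - 2) • a - ‖b‖ ^ (p - 2) • b, a - b⟫ := by
  have key : ∀ r : ℝ, 0 ≤ r → r ^ (p - 2) * r = r ^ (p - 1) := by
    intro r hr
    rcases hr.eq_or_lt with h | h
    · rw [← h, Real.zero_rpow (by linarith : p - 1 ≠ 0)]; simp
    · rw [← Real.rpow_add_one h.ne']; ring_nf
  by_cases hn : ‖a‖ = ‖b‖
  · rw [hn, ← smul_sub, real_inner_smul_left, real_inner_self_eq_norm_sq]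
    have hb : 0 < ‖b‖ := by
      rw [norm_pos_iff]
      rintro rfl
      simp at hn
      exact hab hn
    have : 0 < ‖a - b‖ := norm_pos_iff.mpr (sub_ne_zero.mpr hab)
    positivity
  · have e : ⟪‖a‖ ^ (p - 2) • a - ‖b‖ ^ (p - 2) • b, a - b⟫ =
      ‖a‖ ^ (p-2) * ‖a‖^2 + ‖b‖ ^ (p-2) * ‖b‖^2 - (‖a‖ ^ (p-2) + ‖b‖ ^ (p-2)) * ⟪a, b⟫ := by
      simp only [inner_sub_left, inner_sub_right, real_inner_smul_left,
        real_inner_self_eq_norm_sq, real_inner_comm a b]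
      ring
    have h1 : (‖a‖ ^ (p-2) + ‖b‖ ^ (p-2)) * ⟪a, b⟫ ≤
        (‖a‖ ^ (p-2) + ‖b‖ ^ (p-2)) * (‖a‖ * ‖b‖) :=
      mul_le_mul_of_nonneg_left (real_inner_le_norm a b) (by positivity)
    have ka := key ‖a‖ (norm_nonneg _)
    have kb := key ‖b‖ (norm_nonneg _)
    have h2 : 0 < (‖a‖ ^ (p-1) - ‖b‖^(p-1)) * (‖a‖ - ‖b‖) := by
      rcases lt_or_gt_of_ne hn with h | h
      · have := Real.rpow_lt_rpow (norm_nonneg _) h (by linarith : 0 < p - 1)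
        exact mul_pos_of_neg_of_neg (by linarith) (by linarith)
      · have := Real.rpow_lt_rpow (norm_nonneg _) h (by linarith : 0 < p - 1)
        exact mul_pos (by linarith) (by linarith)
    rw [← ka, ← kb] at h2
    rw [e]
    nlinarith
end

section
variable {n : ℕ}

theorem wcp_mollify (Ω K : Set (EuclideanSpace ℝ (Fin n))) (hΩ : IsOpen Ω) (hK : IsCompact K)
    (hKΩ : K ⊆ Ω) (φ : EuclideanSpace ℝ (Fin n) → ℝ) (hφ : ContDiff ℝ 1 φ)
    (hφ0 : ∀ x, 0 ≤ φ x) (hφK : ∀ x, x ∉ K → φ x = 0) :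
    ∃ K' : Set (EuclideanSpace ℝ (Fin n)), IsCompact K' ∧ K ⊆ K' ∧ K' ⊆ Ω ∧ ∀ δ : ℝ, 0 < δ →
      ∃ ψ : EuclideanSpace ℝ (Fin n) → ℝ, IsTestFun n Ω ψ ∧ (∀ x, 0 ≤ ψ x) ∧
        tsupport ψ ⊆ K' ∧ ∀ x, ‖gradient ψ x - gradient φ x‖ ≤ δ := by
  obtain ⟨r, hr, hrΩ⟩ := hK.exists_cthickening_subset_open hΩ hKΩ
  have hsupp : Function.support φ ⊆ K := fun x hx => by
    by_contra h
    exact hx (hφK x h)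
  have hcφ : HasCompactSupport φ := HasCompactSupport.of_support_subset_isCompact hK hsupp
  have hcφ' : HasCompactSupport (fderiv ℝ φ) := hcφ.fderiv ℝ
  have hcont' : Continuous (fderiv ℝ φ) := hφ.continuous_fderiv (by norm_num)
  have huc : UniformContinuous (fderiv ℝ φ) := hcφ'.uniformContinuous_of_continuous hcont'
  refine ⟨cthickening r K, hK.cthickening, self_subset_cthickening K, hrΩ, fun δ hδ => ?_⟩
  obtain ⟨η, hη, hηδ⟩ := Metric.uniformContinuous_iff.1 huc δ hδ
  let ρ := min r η
  have hρ : 0 < ρ := lt_min hr hη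
  let b : ContDiffBump (0 : EuclideanSpace ℝ (Fin n)) := ⟨ρ / 2, ρ, by linarith, by linarith⟩
  let f := b.normed volume
  let ψ := convolution f φ (ContinuousLinearMap.lsmul ℝ ℝ) volume
  have hts : tsupport ψ ⊆ cthickening r K := by
    apply closure_minimal _ isClosed_cthickening
    refine (support_convolution_subset_swap _).trans ?_
    rintro x ⟨y, hy, z, hz, rfl⟩
    have hz' : z ∈ ball (0 : EuclideanSpace ℝ (Fin n)) ρ := by
      have := b.support_normed_eq (μ := volume)
      rw [this] at hz
      exact hz
    apply mem_cthickening_of_dist_le _ y _ _ (hsupp hy)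
    simp at hz' ⊢
    exact hz'.le.trans (min_le_left _ _)
  have hd : ∀ x, HasFDerivAt ψ ((convolution f (fderiv ℝ φ)
      (ContinuousLinearMap.lsmul ℝ ℝ) volume) x) x := by
    intro x
    have h := hcφ.hasFDerivAt_convolution_right (ContinuousLinearMap.lsmul ℝ ℝ)
      (μ := volume) (f := f) (b.continuous_normed.locallyIntegrable) hφ x
    have e : convolution f (fderiv ℝ φ) (ContinuousLinearMap.lsmul ℝ ℝ) volume x =
        convolution f (fderiv ℝ φ) (ContinuousLinearMap.precompR (EuclideanSpace ℝ (Fin n))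
          (ContinuousLinearMap.lsmul ℝ ℝ)) volume x := by
      unfold convolution
      refine integral_congr_ae (Filter.Eventually.of_forall fun t => ?_)
      ext v
      simp [ContinuousLinearMap.precompR_apply]
    rw [e]
    exact h
  refine ⟨ψ, ⟨?_, ?_, hts.trans hrΩ⟩, ?_, hts, ?_⟩
  · exact b.hasCompactSupport_normed.contDiff_convolution_left _ b.contDiff_normed
      hφ.continuous.locallyIntegrable
  · exact HasCompactSupport.of_support_subset_isCompact hK.cthickening
      ((subset_tsupport _).trans hts)
  · intro x
    apply integral_nonneg
    intro t
    simp only [ContinuousLinearMap.lsmul_apply]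
    exact mul_nonneg (b.nonneg_normed _) (hφ0 _)
  · intro x
    unfold gradient
    rw [← map_sub, LinearIsometryEquiv.norm_map, (hd x).fderiv, ← dist_eq_norm]
    apply b.dist_normed_convolution_le hcont'.aestronglyMeasurable
    intro y hy
    apply (hηδ _).le
    exact (mem_ball.1 hy).trans_le (min_le_right _ _)

instance wcp_fin : IsLocallyFiniteMeasure (gaussianMeasure n) := by
  unfold gaussianMeasure
  exact IsLocallyFiniteMeasure.withDensity_ofReal (by fun_prop)

instance wcp_pos : (gaussianMeasure n).IsOpenPosMeasure := by
  unfold gaussianMeasure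
  apply (withDensity_absolutelyContinuous' (μ := volume) _ _).isOpenPosMeasure
  · fun_prop
  · refine Filter.Eventually.of_forall fun x => ?_
    have : 0 < (2 * π) ^ (-(n : ℝ) / 2) * Real.exp (-‖x‖ ^ 2 / 2) := by positivity
    simpa using this

/-- a continuous field on Ω paired with a continuous field supported in compact K ⊂ Ω -/
theorem wcp_pair_cont (Ω K : Set (EuclideanSpace ℝ (Fin n))) (hΩ : IsOpen Ω) (hK : IsCompact K)
    (hKΩ : K ⊆ Ω) (V G : EuclideanSpace ℝ (Fin n) → EuclideanSpace ℝ (Fin n))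
    (hV : ContinuousOn V Ω) (hG : Continuous G) (hGK : ∀ x, x ∉ K → G x = 0) :
    Continuous (fun x => ⟪V x, G x⟫) ∧ HasCompactSupport (fun x => ⟪V x, G x⟫) := by
  constructor
  · rw [continuous_iff_continuousAt]
    intro x
    by_cases hx : x ∈ K
    · exact (hV.continuousAt (hΩ.mem_nhds (hKΩ hx))).inner hG.continuousAt
    · apply ContinuousAt.congr (f := fun _ => (0 : ℝ)) continuousAt_const
      filter_upwards [hK.isClosed.isOpen_compl.mem_nhds hx] with y hy
      rw [hGK y hy, inner_zero_right]
  · apply HasCompactSupport.of_support_subset_isCompact hK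
    intro x hx
    by_contra h
    apply hx
    simp [hGK x h]

theorem wcp_grad_cont (φ : EuclideanSpace ℝ (Fin n) → ℝ) (hφ : ContDiff ℝ 1 φ) :
    Continuous (gradient φ) := by
  unfold gradient
  exact (LinearIsometryEquiv.continuous _).comp (hφ.continuous_fderiv (by norm_num))

theorem wcp_grad_zero (K : Set (EuclideanSpace ℝ (Fin n))) (φ : EuclideanSpace ℝ (Fin n) → ℝ)
    (h : tsupport φ ⊆ K) (x) (hx : x ∉ K) : gradient φ x = 0 := by
  unfold gradient
  have : fderiv ℝ φ x = 0 := by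
    by_contra h'
    exact hx (h (support_fderiv_subset ℝ h'))
  simp [this]

theorem wcp_C1 (Ω K : Set (EuclideanSpace ℝ (Fin n))) (hΩ : IsOpen Ω) (hK : IsCompact K)
    (hKΩ : K ⊆ Ω) (V₁ V₂ : EuclideanSpace ℝ (Fin n) → EuclideanSpace ℝ (Fin n))
    (hV₁ : ContinuousOn V₁ Ω) (hV₂ : ContinuousOn V₂ Ω)
    (hcomp : ∀ φ : EuclideanSpace ℝ (Fin n) → ℝ, IsTestFun n Ω φ → (∀ x, 0 ≤ φ x) →
      ∫ x in Ω, ⟪V₁ x, gradient φ x⟫ ∂(gaussianMeasure n)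
        ≤ ∫ x in Ω, ⟪V₂ x, gradient φ x⟫ ∂(gaussianMeasure n))
    (φ : EuclideanSpace ℝ (Fin n) → ℝ) (hφ : ContDiff ℝ 1 φ)
    (hφ0 : ∀ x, 0 ≤ φ x) (hφK : ∀ x, x ∉ K → φ x = 0) :
    ∫ x, ⟪V₁ x - V₂ x, gradient φ x⟫ ∂(gaussianMeasure n) ≤ 0 := by
  obtain ⟨K', hK', hKK', hK'Ω, H⟩ := wcp_mollify Ω K hΩ hK hKΩ φ hφ hφ0 hφK
  have hV : ContinuousOn (fun x => V₁ x - V₂ x) Ω := hV₁.sub hV₂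
  obtain ⟨C, hC⟩ := hK'.exists_bound_of_continuousOn (hV.mono hK'Ω)
  have hφt : tsupport φ ⊆ K' := by
    apply closure_minimal _ hK'.isClosed
    intro x hx
    by_contra h
    exact hx (hφK x (fun h' => h (hKK' h')))
  have key : ∀ δ : ℝ, 0 < δ → ∫ x, ⟪V₁ x - V₂ x, gradient φ x⟫ ∂(gaussianMeasure n) ≤
      |C| * δ * (gaussianMeasure n).real K' := by
    intro δ hδ
    obtain ⟨ψ, hψ, hψ0, hψK, hψδ⟩ := H δ hδ
    have hψ1 : ContDiff ℝ 1 ψ := hψ.1.of_le (by exact_mod_cast le_top)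
    have int : ∀ W : EuclideanSpace ℝ (Fin n) → EuclideanSpace ℝ (Fin n), ContinuousOn W Ω →
        ∀ χ : EuclideanSpace ℝ (Fin n) → ℝ, ContDiff ℝ 1 χ → tsupport χ ⊆ K' →
        Integrable (fun x => ⟪W x, gradient χ x⟫) (gaussianMeasure n) := by
      intro W hW χ hχ hχK
      obtain ⟨h1, h2⟩ := wcp_pair_cont Ω K' hΩ hK' hK'Ω W (gradient χ) hW
        (wcp_grad_cont χ hχ) (wcp_grad_zero K' χ hχK)
      exact h1.integrable_of_hasCompactSupport h2
    have seteq : ∀ W : EuclideanSpace ℝ (Fin n) → EuclideanSpace ℝ (Fin n),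
        ∫ x in Ω, ⟪W x, gradient ψ x⟫ ∂(gaussianMeasure n) =
        ∫ x, ⟪W x, gradient ψ x⟫ ∂(gaussianMeasure n) := by
      intro W
      apply setIntegral_eq_integral_of_forall_compl_eq_zero
      intro x hx
      rw [wcp_grad_zero K' ψ hψK x (fun h => hx (hK'Ω h)), inner_zero_right]
    have h1 := hcomp ψ hψ hψ0
    rw [seteq, seteq] at h1
    have h2 : ∫ x, ⟪V₁ x - V₂ x, gradient ψ x⟫ ∂(gaussianMeasure n) ≤ 0 := by
      simp only [inner_sub_left]
      rw [integral_sub (int V₁ hV₁ ψ hψ1 hψK) (int V₂ hV₂ ψ hψ1 hψK)]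
      linarith
    have h3 : ∫ x, ⟪V₁ x - V₂ x, gradient φ x⟫ ∂(gaussianMeasure n) -
        ∫ x, ⟪V₁ x - V₂ x, gradient ψ x⟫ ∂(gaussianMeasure n) ≤
        |C| * δ * (gaussianMeasure n).real K' := by
      rw [← integral_sub (int _ hV φ hφ hφt) (int _ hV ψ hψ1 hψK)]
      rw [← setIntegral_eq_integral_of_forall_compl_eq_zero (s := K')]
      · refine (le_abs_self _).trans ?_
        rw [← Real.norm_eq_abs]
        apply norm_setIntegral_le_of_norm_le_const hK'.measure_lt_top
        intro x hx
        rw [← inner_sub_right]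
        refine (norm_inner_le_norm _ _).trans ?_
        rw [norm_sub_rev (gradient φ x)]
        exact mul_le_mul ((hC x hx).trans (le_abs_self _)) (hψδ x) (norm_nonneg _) (abs_nonneg _)
      · intro x hx
        rw [wcp_grad_zero K' ψ hψK x hx, wcp_grad_zero K' φ hφt x hx]
        simp
    linarith
  apply le_of_forall_pos_le_add
  intro ε hε
  set M := |C| * (gaussianMeasure n).real K'
  have hM : 0 ≤ M := by positivity
  have := key (ε / (M + 1)) (by positivity)
  refine this.trans ?_
  rw [zero_add, show |C| * (ε / (M + 1)) * (gaussianMeasure n).real K' = ε * (M / (M + 1)) by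
    simp only [M]; ring]
  have : M / (M + 1) ≤ 1 := by
    rw [div_le_one (by positivity)]; linarith
  nlinarith

end

/-- **Weak comparison principle for the Gaussian-weighted `p`-Laplacian**
(Proposition 3.3 of the paper): if `u₁` is a weak subsolution relative to `u₂`
(tested against all nonnegative smooth compactly supported functions) and `u₁ ≤ u₂` on
`∂Ω`, then `u₁ ≤ u₂` in `Ω`. -/
theorem weak_comparison_principle
    (n : ℕ) (hn : 2 ≤ n) (p : ℝ) (hp : 1 < p)
    (Ω : Set (EuclideanSpace ℝ (Fin n)))
    (hΩo : IsOpen Ω) (hΩb : IsBounded Ω) (hΩ2 : HasC2Boundary n Ω)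
    (u₁ u₂ : EuclideanSpace ℝ (Fin n) → ℝ)
    (hu₁1 : ContDiffOn ℝ 1 u₁ (closure Ω)) (hu₂1 : ContDiffOn ℝ 1 u₂ (closure Ω))
    (hcomp : ∀ φ : EuclideanSpace ℝ (Fin n) → ℝ, IsTestFun n Ω φ → (∀ x, 0 ≤ φ x) →
      ∫ x in Ω, ‖gradient u₁ x‖ ^ (p - 2) * ⟪gradient u₁ x, gradient φ x⟫ ∂(gaussianMeasure n)
        ≤ ∫ x in Ω, ‖gradient u₂ x‖ ^ (p - 2) * ⟪gradient u₂ x, gradient φ x⟫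
            ∂(gaussianMeasure n))
    (hbdry : ∀ x ∈ frontier Ω, u₁ x ≤ u₂ x) :
    ∀ x ∈ Ω, u₁ x ≤ u₂ x := by
  intro x₀ hx₀
  by_contra hlt
  push Not at hlt
  set w : EuclideanSpace ℝ (Fin n) → ℝ := fun x => u₁ x - u₂ x with hw
  have hm : 0 < w x₀ := by simp only [hw]; linarith
  set ε := w x₀ / 2 with hε
  have hε0 : 0 < ε := by positivity
  have hwc : ContDiffOn ℝ 1 w (closure Ω) := hu₁1.sub hu₂1
  have hcomp' : IsCompact (closure Ω) := hΩb.isCompact_closure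
  let K := closure Ω ∩ w ⁻¹' (Ici ε)
  have hKc : IsCompact K := by
    apply hcomp'.of_isClosed_subset _ inter_subset_left
    exact hwc.continuousOn.preimage_isClosed_of_isClosed isClosed_closure isClosed_Ici
  have hKΩ : K ⊆ Ω := by
    rintro x ⟨hx, hxw⟩
    by_contra hxΩ
    have : x ∈ frontier Ω := ⟨hx, by rwa [hΩo.interior_eq]⟩
    have h1 := hbdry x this
    have h2 : ε ≤ u₁ x - u₂ x := hxw
    linarith
  let h : ℝ → ℝ := fun t => Real.smoothTransition (t - ε)
  have hh : ContDiff ℝ 1 h :=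
    (Real.smoothTransition.contDiff (n := 1)).comp (contDiff_id.sub contDiff_const)
  have hhm : Monotone h := fun a b hab => Real.smoothTransition.monotone (by linarith)
  let φ : EuclideanSpace ℝ (Fin n) → ℝ := Ω.indicator (h ∘ w)
  have hφK : ∀ x, x ∉ K → φ x = 0 := by
    intro x hx
    by_cases hxΩ : x ∈ Ω
    · simp only [φ, indicator_of_mem hxΩ]
      apply Real.smoothTransition.zero_of_nonpos
      by_contra hc
      exact hx ⟨subset_closure hxΩ, by simp only [mem_preimage, mem_Ici]; linarith⟩
    · simp only [φ, indicator_of_notMem hxΩ]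
  have hφ0 : ∀ x, 0 ≤ φ x := fun x =>
    indicator_nonneg (fun y _ => Real.smoothTransition.nonneg _) x
  have hloc : ∀ x ∈ Ω, φ =ᶠ[𝓝 x] h ∘ w := by
    intro x hx
    filter_upwards [hΩo.mem_nhds hx] with y hy
    simp only [φ, indicator_of_mem hy]
  have hat : ∀ u : EuclideanSpace ℝ (Fin n) → ℝ, ContDiffOn ℝ 1 u (closure Ω) → ∀ x ∈ Ω,
      ContDiffAt ℝ 1 u x := fun u hu x hx =>
    hu.contDiffAt (Filter.mem_of_superset (hΩo.mem_nhds hx) subset_closure)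
  have hφ1 : ContDiff ℝ 1 φ := by
    rw [contDiff_iff_contDiffAt]
    intro x
    by_cases hx : x ∈ K
    · have hxΩ := hKΩ hx
      exact (hh.contDiffAt.comp x (hat w hwc x hxΩ)).congr_of_eventuallyEq (hloc x hxΩ)
    · apply (contDiffAt_const (c := (0 : ℝ))).congr_of_eventuallyEq
      filter_upwards [hKc.isClosed.isOpen_compl.mem_nhds hx] with y hy
      exact hφK y hy
  have hgc : ∀ u : EuclideanSpace ℝ (Fin n) → ℝ, ContDiffOn ℝ 1 u (closure Ω) →
      ContinuousOn (fun x => ‖gradient u x‖ ^ (p - 2) • gradient u x) Ω := by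
    intro u hu
    have : ContinuousOn (gradient u) Ω := by
      unfold gradient
      exact (LinearIsometryEquiv.continuous _).comp_continuousOn
        ((hu.mono subset_closure).continuousOn_fderiv_of_isOpen hΩo (by norm_num))
    exact (wcp_A_cont p hp).comp_continuousOn this
  have hle := wcp_C1 Ω K hΩo hKc hKΩ _ _ (hgc u₁ hu₁1) (hgc u₂ hu₂1)
    (by simpa only [real_inner_smul_left] using hcomp) φ hφ1 hφ0 hφK
  have hφt : tsupport φ ⊆ K := by
    apply closure_minimal _ hKc.isClosed
    intro x hx
    by_contra hc
    exact hx (hφK x hc)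
  obtain ⟨hgcont, hgsupp⟩ := wcp_pair_cont Ω K hΩo hKc hKΩ _ (gradient φ)
    ((hgc u₁ hu₁1).sub (hgc u₂ hu₂1)) (wcp_grad_cont φ hφ1) (wcp_grad_zero K φ hφt)
  have hgrad : ∀ x ∈ Ω, gradient φ x = deriv h (w x) • (gradient u₁ x - gradient u₂ x) := by
    intro x hx
    have d1 := (hat u₁ hu₁1 x hx).differentiableAt (by norm_num)
    have d2 := (hat u₂ hu₂1 x hx).differentiableAt (by norm_num)
    have dw : HasFDerivAt w (fderiv ℝ u₁ x - fderiv ℝ u₂ x) x := d1.hasFDerivAt.sub d2.hasFDerivAt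
    have dh : HasDerivAt h (deriv h (w x)) (w x) :=
      (hh.differentiable (by norm_num) _).hasDerivAt
    have := (dh.comp_hasFDerivAt x dw).congr_of_eventuallyEq (hloc x hx)
    unfold gradient
    rw [this.fderiv]
    simp
  have hd0 : ∀ t, 0 ≤ deriv h t := fun t => hhm.deriv_nonneg
  have hpt : ∀ x, 0 ≤ ⟪‖gradient u₁ x‖ ^ (p - 2) • gradient u₁ x -
      ‖gradient u₂ x‖ ^ (p - 2) • gradient u₂ x, gradient φ x⟫ := by
    intro x
    by_cases hx : x ∈ Ω
    · rw [hgrad x hx, real_inner_smul_right]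
      apply mul_nonneg (hd0 _)
      by_cases hab : gradient u₁ x = gradient u₂ x
      · simp [hab]
      · exact (wcp_A_mono p hp _ _ hab).le
    · rw [wcp_grad_zero K φ hφt x (fun hc => hx (hKΩ hc)), inner_zero_right]
  have hgz : ∀ x, gradient φ x = 0 := by
    intro x
    by_contra hne
    have hx : x ∈ Ω := by
      by_contra hc
      exact hne (wcp_grad_zero K φ hφt x (fun hc' => hc (hKΩ hc')))
    have hpos := hgcont.integral_pos_of_hasCompactSupport_nonneg_nonzero
      (μ := gaussianMeasure n) (x := x) hgsupp hpt (by
        have hne' := hne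
        rw [hgrad x hx] at hne'
        rw [smul_eq_zero, not_or, sub_eq_zero] at hne'
        simp only [Pi.sub_apply]
        rw [hgrad x hx, real_inner_smul_right]
        exact mul_ne_zero hne'.1 (wcp_A_mono p hp _ _ hne'.2).ne')
    exact absurd hle (not_le.2 hpos)
  have hfz : ∀ x, fderiv ℝ φ x = 0 := by
    intro x
    have := hgz x
    unfold gradient at this
    simpa using this
  have hne : Ω ≠ univ := by
    rintro rfl
    have : Nonempty (Fin n) := ⟨⟨0, by omega⟩⟩
    exact NormedSpace.unbounded_univ ℝ (EuclideanSpace ℝ (Fin n)) hΩb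
  obtain ⟨y, hy⟩ := (ne_univ_iff_exists_notMem Ω).1 hne
  have hc := is_const_of_fderiv_eq_zero (hφ1.differentiable (by norm_num)) hfz x₀ y
  have e1 : φ y = 0 := indicator_of_notMem hy _
  have e2 : 0 < φ x₀ := by
    simp only [φ, indicator_of_mem hx₀]
    apply Real.smoothTransition.pos_of_pos
    linarith
  linarith
end

section
/- Let n ≥ 2, p > 1, and 0 < r₀ < r₁. Define φ : [r₀, r₁] → ℝ by φ(r) = (∫_{r₀}^{r} (e^{t²/2} t^{1-n})^{1/(p-1)} dt) / (∫_{r₀}^{r₁} (e^{t²/2} t^{1-n})^{1/(p-1)} dt), and u : cl B(0,r₁) \ B(0,r₀) → ℝ by u(x) = φ(‖x‖). Then: (i) u is smooth on the open annulus A = { x : r₀ < ‖x‖ < r₁ } and satisfies pointwise div(e^{-‖x‖²/2} ‖∇u‖^{p-2} ∇u) = 0 in A; (ii) u = 0 on { ‖x‖ = r₀ } and u = 1 on { ‖x‖ = r₁ }; (iii) 0 < u < 1 in A; (iv) there exists c > 0 with ‖∇u(x)‖ ≥ c for all x ∈ A; and (v) u is the unique function in C¹(cl A) with these boundary values satisfying,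 for every φ ∈ C_c^∞(A), ∫_A e^{-‖x‖²/2} ‖∇u‖^{p-2} ⟨∇u, ∇φ⟩ dx = 0. -/
open MeasureTheory Real Set Metric Bornology
open scoped RealInnerProductSpace Pointwise NNReal Topology

section Helpers

variable {n : ℕ}

lemma rsa_exists_moll (Ψ : EuclideanSpace ℝ (Fin n) → ℝ) (hΨ : ContDiff ℝ 1 Ψ)
    (hc : HasCompactSupport Ψ) (δ : ℝ) (hδ : 0 < δ) (ε : ℝ) (hε : 0 < ε) :
    ∃ ψ : EuclideanSpace ℝ (Fin n) → ℝ, ContDiff ℝ (⊤ : ℕ∞) ψ ∧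
      tsupport ψ ⊆ cthickening δ (tsupport Ψ) ∧ ∀ x, ‖gradient ψ x - gradient Ψ x‖ ≤ ε := by
  have hcont : Continuous (fderiv ℝ Ψ) := hΨ.continuous_fderiv one_ne_zero
  have huc : UniformContinuous (fderiv ℝ Ψ) :=
    (hc.fderiv ℝ).uniformContinuous_of_continuous hcont
  obtain ⟨δ', hδ', h⟩ := Metric.uniformContinuous_iff.mp huc ε hε
  set r := min δ δ' with hrdef
  have hr : 0 < r := lt_min hδ hδ'
  set b : ContDiffBump (0 : EuclideanSpace ℝ (Fin n)) := ⟨r / 2, r, half_pos hr, half_lt_self hr⟩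
  have hli : LocallyIntegrable (b.normed volume) volume :=
    b.continuous_normed.locallyIntegrable
  refine ⟨convolution (b.normed volume) Ψ (ContinuousLinearMap.lsmul ℝ ℝ) volume, ?_, ?_, ?_⟩
  · exact b.hasCompactSupport_normed.contDiff_convolution_left _ b.contDiff_normed
      hΨ.continuous.locallyIntegrable
  · refine closure_minimal ?_ isClosed_cthickening
    refine (support_convolution_subset _).trans ?_
    rintro x ⟨y, hy, z, hz, rfl⟩
    rw [b.support_normed_eq] at hy
    refine mem_cthickening_of_dist_le _ z _ _ (subset_tsupport _ hz) ?_
    have h1 : ‖y‖ < r := by simpa using hy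
    simp only [dist_eq_norm, add_sub_cancel_right]
    exact h1.le.trans (min_le_left _ _)
  · intro x
    have h1 := (hc.hasFDerivAt_convolution_right (ContinuousLinearMap.lsmul ℝ ℝ) hli hΨ x)
    have h2 : (ContinuousLinearMap.lsmul ℝ ℝ : ℝ →L[ℝ] ℝ →L[ℝ] ℝ).precompR
        (EuclideanSpace ℝ (Fin n)) = ContinuousLinearMap.lsmul ℝ ℝ := by
      ext; simp
    rw [h2] at h1
    unfold gradient
    rw [h1.fderiv, ← map_sub, LinearIsometryEquiv.norm_map, ← dist_eq_norm]
    apply b.dist_normed_convolution_le hcont.aestronglyMeasurable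
    intro y hy
    exact (h (lt_of_lt_of_le (mem_ball.mp hy) (min_le_right _ _))).le

lemma rsa_gradient_cont {Ψ : EuclideanSpace ℝ (Fin n) → ℝ} (hΨ : ContDiff ℝ 1 Ψ) :
    Continuous (gradient Ψ) :=
  (LinearIsometryEquiv.continuous _).comp (hΨ.continuous_fderiv one_ne_zero)

lemma rsa_gradient_supp {Ψ : EuclideanSpace ℝ (Fin n) → ℝ} {x : EuclideanSpace ℝ (Fin n)}
    (hx : x ∉ tsupport Ψ) : gradient Ψ x = 0 := by
  unfold gradient
  rw [fderiv_of_notMem_tsupport ℝ hx, map_zero]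

lemma rsa_inner_cont {A : Set (EuclideanSpace ℝ (Fin n))} (hA : IsOpen A)
    {G : EuclideanSpace ℝ (Fin n) → EuclideanSpace ℝ (Fin n)} (hG : ContinuousOn G A)
    {Ψ : EuclideanSpace ℝ (Fin n) → ℝ} (hΨ : ContDiff ℝ 1 Ψ) (hs : tsupport Ψ ⊆ A) :
    Continuous (fun x => ⟪G x, gradient Ψ x⟫) := by
  rw [continuous_iff_continuousAt]
  intro x
  by_cases hx : x ∈ A
  · exact (hG.continuousAt (hA.mem_nhds hx)).inner (rsa_gradient_cont hΨ).continuousAt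
  · have hx' : x ∉ tsupport Ψ := fun h => hx (hs h)
    refine (continuousAt_const (y := (0:ℝ))).congr ?_
    filter_upwards [(isClosed_tsupport Ψ).isOpen_compl.mem_nhds hx'] with y hy
    rw [rsa_gradient_supp hy, inner_zero_right]

lemma rsa_inner_supp
    {G : EuclideanSpace ℝ (Fin n) → EuclideanSpace ℝ (Fin n)}
    {Ψ : EuclideanSpace ℝ (Fin n) → ℝ} (hc : HasCompactSupport Ψ) :
    HasCompactSupport (fun x => ⟪G x, gradient Ψ x⟫) :=
  HasCompactSupport.intro hc (fun x hx => by
    rw [rsa_gradient_supp hx, inner_zero_right])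

lemma rsa_weak_C1 {A : Set (EuclideanSpace ℝ (Fin n))} (hA : IsOpen A)
    {G : EuclideanSpace ℝ (Fin n) → EuclideanSpace ℝ (Fin n)} (hG : ContinuousOn G A)
    (hw : ∀ ψ, IsTestFun n A ψ → ∫ x, ⟪G x, gradient ψ x⟫ = 0)
    {Ψ : EuclideanSpace ℝ (Fin n) → ℝ} (hΨ : ContDiff ℝ 1 Ψ) (hc : HasCompactSupport Ψ)
    (hs : tsupport Ψ ⊆ A) : ∫ x, ⟪G x, gradient Ψ x⟫ = 0 := by
  have hK : IsCompact (tsupport Ψ) := hc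
  obtain ⟨δ, hδ, hδA⟩ := hK.exists_cthickening_subset_open hA hs
  set K := cthickening δ (tsupport Ψ) with hKdef
  have hKc : IsCompact K := hK.cthickening
  obtain ⟨M, hM⟩ := hKc.exists_bound_of_continuousOn (hG.mono hδA)
  have key : ∀ ε : ℝ, 0 < ε → ‖∫ x, ⟪G x, gradient Ψ x⟫‖ ≤ ε * (|M| * volume.real K) := by
    intro ε hε
    obtain ⟨ψ, hψ, hψs, hψg⟩ := rsa_exists_moll Ψ hΨ hc δ hδ ε hε
    have hψc : HasCompactSupport ψ := hKc.of_isClosed_subset (isClosed_tsupport _) hψs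
    have h0 := hw ψ ⟨hψ, hψc, hψs.trans hδA⟩
    have hψ1 : ContDiff ℝ 1 ψ := hψ.of_le (by exact_mod_cast le_top)
    have i1 := (rsa_inner_cont hA hG hΨ hs).integrable_of_hasCompactSupport (μ := volume)
      (rsa_inner_supp (G := G) hc)
    have i2 := (rsa_inner_cont hA hG hψ1 (hψs.trans hδA)).integrable_of_hasCompactSupport
      (μ := volume) (rsa_inner_supp (G := G) hψc)
    have e1 : ∫ x, ⟪G x, gradient Ψ x⟫ = ∫ x, (⟪G x, gradient Ψ x⟫ - ⟪G x, gradient ψ x⟫) := by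
      rw [integral_sub i1 i2, h0, sub_zero]
    have e2 : ∫ x, (⟪G x, gradient Ψ x⟫ - ⟪G x, gradient ψ x⟫)
        = ∫ x in K, (⟪G x, gradient Ψ x⟫ - ⟪G x, gradient ψ x⟫) := by
      symm
      apply setIntegral_eq_integral_of_forall_compl_eq_zero
      intro x hx
      rw [rsa_gradient_supp (fun h => hx (self_subset_cthickening _ h)),
        rsa_gradient_supp (fun h => hx (hψs h))]
      simp
    rw [e1, e2]
    have := norm_setIntegral_le_of_norm_le_const (μ := volume) (s := K) (C := ε * |M|)
      (f := fun x => ⟪G x, gradient Ψ x⟫ - ⟪G x, gradient ψ x⟫) hKc.measure_lt_top ?_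
    · rw [← mul_assoc]; exact this
    · intro x hx
      rw [← inner_sub_right]
      refine (norm_inner_le_norm _ _).trans ?_
      rw [mul_comm]
      have := hψg x
      rw [norm_sub_rev] at this
      exact mul_le_mul this ((hM x hx).trans (le_abs_self M)) (norm_nonneg _) hε.le
  set C := |M| * volume.real K with hC
  have hC0 : 0 ≤ C := by positivity
  by_contra hne
  have hpos : 0 < ‖∫ x, ⟪G x, gradient Ψ x⟫‖ := norm_pos_iff.mpr hne
  set I := ‖∫ x, ⟪G x, gradient Ψ x⟫‖
  have := key (I / (2 * (C + 1))) (by positivity)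
  have h2 : I / (2 * (C + 1)) * C ≤ I / 2 := by
    rw [div_mul_eq_mul_div, div_le_div_iff₀ (by positivity) (by positivity)]
    nlinarith
  linarith

/-- the divergence theorem for compactly supported functions -/
lemma rsa_weak_of_div {A : Set (EuclideanSpace ℝ (Fin n))} (hA : IsOpen A)
    {G : EuclideanSpace ℝ (Fin n) → EuclideanSpace ℝ (Fin n)} (hG : ContDiffOn ℝ 1 G A)
    (hdiv : ∀ x ∈ A, (∑ i : Fin n, (fderiv ℝ G x (EuclideanSpace.single i 1)) i) = 0)
    {Ψ : EuclideanSpace ℝ (Fin n) → ℝ} (hΨ : ContDiff ℝ 1 Ψ) (hc : HasCompactSupport Ψ)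
    (hs : tsupport Ψ ⊆ A) : ∫ x, ⟪G x, gradient Ψ x⟫ = 0 := by
  have hcd : ∀ i : Fin n, ContDiff ℝ 1 (fun x => Ψ x * G x i) := by
    intro i
    rw [contDiff_iff_contDiffAt]
    intro x
    by_cases hx : x ∈ A
    · have h1 : ContDiffAt ℝ 1 G x := hG.contDiffAt (hA.mem_nhds hx)
      have h2 : ContDiffAt ℝ 1 (fun y => G y i) x := by
        exact (EuclideanSpace.proj i : _ →L[ℝ] ℝ).contDiff.contDiffAt.comp x h1
      exact hΨ.contDiffAt.mul h2
    · have hx' : x ∉ tsupport Ψ := fun h => hx (hs h)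
      refine (contDiffAt_const (c := (0:ℝ))).congr_of_eventuallyEq ?_
      filter_upwards [(isClosed_tsupport Ψ).isOpen_compl.mem_nhds hx'] with y hy
      rw [image_eq_zero_of_notMem_tsupport hy, zero_mul]
  have hcs : ∀ i : Fin n, HasCompactSupport (fun x => Ψ x * G x i) := fun i => hc.mul_right
  have hint : ∀ i : Fin n, Integrable
      (fun x => fderiv ℝ (fun x => Ψ x * G x i) x (EuclideanSpace.single i 1)) volume := by
    intro i
    refine Continuous.integrable_of_hasCompactSupport ?_ ?_
    · exact ((hcd i).continuous_fderiv one_ne_zero).clm_apply continuous_const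
    · exact (hcs i).fderiv_apply ℝ _
  have hz : ∀ i : Fin n,
      ∫ x, fderiv ℝ (fun x => Ψ x * G x i) x (EuclideanSpace.single i 1) = 0 := by
    intro i
    have := integral_mul_fderiv_eq_neg_fderiv_mul_of_integrable (μ := volume)
      (f := fun _ : EuclideanSpace ℝ (Fin n) => (1:ℝ)) (g := fun x => Ψ x * G x i)
      (v := EuclideanSpace.single i 1) (by simp) (by simpa using hint i)
      (by simpa using (hcd i).continuous.integrable_of_hasCompactSupport (hcs i))
      (by intro x _; fun_prop) (fun x _ => (hcd i).differentiable one_ne_zero x)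
    simpa using this
  have hsum : ∀ x, ⟪G x, gradient Ψ x⟫ =
      ∑ i : Fin n, fderiv ℝ (fun x => Ψ x * G x i) x (EuclideanSpace.single i 1) := by
    intro x
    by_cases hx : x ∈ A
    · have h1 : HasFDerivAt G (fderiv ℝ G x) x :=
        ((hG.contDiffAt (hA.mem_nhds hx)).differentiableAt one_ne_zero).hasFDerivAt
      have h3 : HasFDerivAt Ψ (fderiv ℝ Ψ x) x := (hΨ.differentiable one_ne_zero x).hasFDerivAt
      have h4 : ∀ i : Fin n, fderiv ℝ (fun x => Ψ x * G x i) x (EuclideanSpace.single i 1)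
          = Ψ x * (fderiv ℝ G x (EuclideanSpace.single i 1)) i
            + G x i * fderiv ℝ Ψ x (EuclideanSpace.single i 1) := by
        intro i
        have h2 : HasFDerivAt (fun y => G y i) ((EuclideanSpace.proj i : _ →L[ℝ] ℝ).comp
          (fderiv ℝ G x)) x :=
          (EuclideanSpace.proj i : _ →L[ℝ] ℝ).hasFDerivAt.comp x h1
        rw [(show HasFDerivAt (fun x => Ψ x * G x i) _ x from h3.mul h2).fderiv]
        simp
      simp_rw [h4]
      rw [Finset.sum_add_distrib, ← Finset.mul_sum, hdiv x hx, mul_zero, zero_add,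
        real_inner_comm]
      unfold gradient
      rw [InnerProductSpace.toDual_symm_apply]
      conv_lhs => rw [← (EuclideanSpace.basisFun (Fin n) ℝ).sum_repr (G x)]
      simp
    · have hx' : x ∉ tsupport Ψ := fun h => hx (hs h)
      rw [rsa_gradient_supp hx', inner_zero_right]
      symm
      apply Finset.sum_eq_zero
      intro i _
      rw [fderiv_of_notMem_tsupport ℝ (fun h => hx' (tsupport_mul_subset_left h))]
      simp
  simp_rw [hsum]
  rw [integral_finsetSum _ (fun i _ => hint i)]
  exact Finset.sum_eq_zero (fun i _ => hz i)

end Helpers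
section Helpers2

variable {V : Type*} [NormedAddCommGroup V] [InnerProductSpace ℝ V]

lemma rsa_rpow_mul {p s : ℝ} (hp : 1 < p) (hs : 0 ≤ s) : s ^ (p - 2) * s = s ^ (p - 1) := by
  rcases hs.eq_or_lt with h | h
  · rw [← h, mul_zero, Real.zero_rpow (by linarith)]
  · rw [show p - 1 = (p - 2) + 1 by ring, Real.rpow_add_one h.ne']

lemma rsa_cont {p : ℝ} (hp : 1 < p) : Continuous (fun z : V => ‖z‖ ^ (p - 2) • z) := by
  rw [continuous_iff_continuousAt]
  intro z
  by_cases hz : z = 0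
  · subst hz
    rw [ContinuousAt, smul_zero, tendsto_zero_iff_norm_tendsto_zero]
    have h1 : ∀ z : V, ‖‖z‖ ^ (p - 2) • z‖ = ‖z‖ ^ (p - 1) := by
      intro z
      rw [norm_smul, Real.norm_of_nonneg (by positivity), rsa_rpow_mul hp (norm_nonneg z)]
    simp_rw [h1]
    have : ContinuousAt (fun z : V => ‖z‖ ^ (p - 1)) 0 :=
      continuous_norm.continuousAt.rpow_const (Or.inr (by linarith))
    have h2 := this.tendsto
    simpa [Real.zero_rpow (show p - 1 ≠ 0 by linarith)] using h2
  · exact (continuous_norm.continuousAt.rpow_const (Or.inl (by simpa using hz))).smul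
      continuousAt_id

lemma rsa_mono {p : ℝ} (hp : 1 < p) (x y : V) :
    0 ≤ ⟪‖x‖ ^ (p - 2) • x - ‖y‖ ^ (p - 2) • y, x - y⟫ ∧
    (⟪‖x‖ ^ (p - 2) • x - ‖y‖ ^ (p - 2) • y, x - y⟫ = 0 → x = y) := by
  have hx := norm_nonneg x
  have hy := norm_nonneg y
  have ax := rsa_rpow_mul hp hx
  have ay := rsa_rpow_mul hp hy
  have px : 0 ≤ ‖x‖ ^ (p - 2) := by positivity
  have py : 0 ≤ ‖y‖ ^ (p - 2) := by positivity
  have hc : 0 ≤ ‖x‖ * ‖y‖ - ⟪x, y⟫ := by linarith [real_inner_le_norm x y]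
  have hexp : ⟪‖x‖ ^ (p - 2) • x - ‖y‖ ^ (p - 2) • y, x - y⟫ =
      (‖x‖ ^ (p - 1) - ‖y‖ ^ (p - 1)) * (‖x‖ - ‖y‖)
      + (‖x‖ ^ (p - 2) + ‖y‖ ^ (p - 2)) * (‖x‖ * ‖y‖ - ⟪x, y⟫) := by
    rw [← ax, ← ay]
    simp only [inner_sub_left, inner_sub_right, real_inner_smul_left,
      real_inner_self_eq_norm_sq, real_inner_comm x y]
    ring
  have h1 : 0 ≤ (‖x‖ ^ (p - 1) - ‖y‖ ^ (p - 1)) * (‖x‖ - ‖y‖) ∧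
      ((‖x‖ ^ (p - 1) - ‖y‖ ^ (p - 1)) * (‖x‖ - ‖y‖) = 0 → ‖x‖ = ‖y‖) := by
    rcases lt_trichotomy ‖x‖ ‖y‖ with h | h | h
    · have := Real.rpow_lt_rpow hx h (show 0 < p - 1 by linarith)
      have h3 : 0 < (‖x‖ ^ (p - 1) - ‖y‖ ^ (p - 1)) * (‖x‖ - ‖y‖) :=
        mul_pos_of_neg_of_neg (by linarith) (by linarith)
      exact ⟨h3.le, fun h => absurd h h3.ne'⟩
    · exact ⟨by rw [h]; simp, fun _ => h⟩
    · have := Real.rpow_lt_rpow hy h (show 0 < p - 1 by linarith)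
      have h3 : 0 < (‖x‖ ^ (p - 1) - ‖y‖ ^ (p - 1)) * (‖x‖ - ‖y‖) :=
        mul_pos (by linarith) (by linarith)
      exact ⟨h3.le, fun h => absurd h h3.ne'⟩
  have h2 : 0 ≤ (‖x‖ ^ (p - 2) + ‖y‖ ^ (p - 2)) * (‖x‖ * ‖y‖ - ⟪x, y⟫) := by positivity
  refine ⟨by rw [hexp]; linarith [h1.1], fun h0 => ?_⟩
  rw [hexp] at h0
  have e := h1.2 (by linarith [h1.1])
  have e2 : (‖x‖ ^ (p - 2) + ‖y‖ ^ (p - 2)) * (‖x‖ * ‖y‖ - ⟪x, y⟫) = 0 := by linarith [h1.1]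
  rcases hy.eq_or_lt with h | h
  · rw [norm_eq_zero.mp h.symm]
    rw [← h] at e
    exact norm_eq_zero.mp e
  · have : 0 < ‖y‖ ^ (p - 2) := by positivity
    have e3 : ‖x‖ * ‖y‖ - ⟪x, y⟫ = 0 := by
      rcases mul_eq_zero.mp e2 with h | h
      · linarith
      · exact h
    rw [← sub_eq_zero, ← norm_eq_zero, ← sq_eq_zero_iff, @norm_sub_sq_real]
    rw [e] at e3 ⊢
    nlinarith

lemma rsa_sqmax (s : ℝ) : HasDerivAt (fun x : ℝ => max x 0 ^ 2) (2 * max s 0) s := by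
  rcases lt_trichotomy s 0 with h | h | h
  · rw [max_eq_right h.le, mul_zero]
    refine (hasDerivAt_const s (0:ℝ)).congr_of_eventuallyEq ?_
    filter_upwards [gt_mem_nhds h] with y hy
    rw [max_eq_right hy.le]; simp
  · subst h
    rw [hasDerivAt_iff_isLittleO]
    simp only [max_self, mul_zero, smul_zero, sub_zero]
    have : (fun x : ℝ => max x 0 ^ 2 - 0 ^ 2) =O[𝓝 0] (fun x : ℝ => x ^ 2) := by
      refine Asymptotics.isBigO_of_le _ (fun x => ?_)
      rcases le_total x 0 with h | h
      · rw [max_eq_right h]; simp [sq_nonneg]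
      · rw [max_eq_left h]; simp
    exact this.trans_isLittleO (by simpa using Asymptotics.isLittleO_pow_id (n := 2) (by norm_num))
  · rw [max_eq_left h.le]
    have := (hasDerivAt_id s).pow 2
    simp only [id] at this
    refine HasDerivAt.congr_of_eventuallyEq (by simpa using this) ?_
    filter_upwards [lt_mem_nhds h] with y hy
    rw [max_eq_left hy.le]
    simp

/-- cut-off nonlinearity -/
lemma rsa_eta (ε : ℝ) (hε : 0 < ε) : ∃ η η' : ℝ → ℝ, ContDiff ℝ 1 η ∧
    (∀ s, HasDerivAt η (η' s) s) ∧ (∀ s, 0 ≤ η' s) ∧ (∀ s, |s| < ε → η s = 0) ∧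
    (∀ s, η s = 0 → |s| ≤ ε) := by
  have hd : ∀ s, HasDerivAt (fun s : ℝ => max (s - ε) 0 ^ 2 - max (-s - ε) 0 ^ 2)
      (2 * max (s - ε) 0 + 2 * max (-s - ε) 0) s := by
    intro s
    have h1 : HasDerivAt (fun s : ℝ => s - ε) 1 s := (hasDerivAt_id s).sub_const ε
    have h2 : HasDerivAt (fun s : ℝ => -s - ε) (-1) s := ((hasDerivAt_id s).neg).sub_const ε
    have := ((rsa_sqmax (s - ε)).comp s h1).sub ((rsa_sqmax (-s - ε)).comp s h2)
    exact HasDerivAt.congr_deriv this (by ring)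
  refine ⟨_, _, ?_, hd, ?_, ?_, ?_⟩
  · rw [contDiff_one_iff_deriv]
    refine ⟨fun s => (hd s).differentiableAt, ?_⟩
    rw [funext (fun s => (hd s).deriv)]
    fun_prop
  · intro s
    positivity
  · intro s hs
    rw [abs_lt] at hs
    rw [max_eq_right (by linarith), max_eq_right (by linarith)]
    simp
  · intro s hs
    by_contra! h
    rcases lt_abs.mp h with h | h
    · rw [max_eq_left (by linarith), max_eq_right (by linarith)] at hs
      nlinarith
    · rw [max_eq_right (by linarith), max_eq_left (by linarith)] at hs
      nlinarith

end Helpers2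
section Helpers3

open Filter

lemma rsa_phi {g φ : ℝ → ℝ} {r₀ r₁ : ℝ} (hr₀ : 0 < r₀) (hr : r₀ < r₁)
    (hg : ContDiffOn ℝ (⊤ : ℕ∞) g (Ioi 0)) (hpos : ∀ t, 0 < t → 0 < g t)
    (hφ : ∀ r, φ r = (∫ t in r₀..r, g t) / (∫ t in r₀..r₁, g t)) :
    0 < (∫ t in r₀..r₁, g t) ∧
    (∀ r, 0 < r → HasDerivAt φ (g r / ∫ t in r₀..r₁, g t) r) ∧
    ContDiffOn ℝ (⊤ : ℕ∞) φ (Ioi 0) ∧ φ r₀ = 0 ∧ φ r₁ = 1 ∧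
    ∀ r, r₀ < r → r < r₁ → 0 < φ r ∧ φ r < 1 := by
  have hgc : ContinuousOn g (Ioi 0) := hg.continuousOn
  have hii : ∀ a b, 0 < a → 0 < b → IntervalIntegrable g volume a b := by
    intro a b ha hb
    apply ContinuousOn.intervalIntegrable
    exact hgc.mono (fun t ht => lt_of_lt_of_le (lt_min ha hb) ht.1)
  have hp : ∀ a b, 0 < a → a < b → 0 < ∫ t in a..b, g t := by
    intro a b ha hab
    exact intervalIntegral.intervalIntegral_pos_of_pos_on (hii a b ha (ha.trans hab))
      (fun t ht => hpos t (ha.trans ht.1)) hab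
  have hI := hp r₀ r₁ hr₀ hr
  have hd : ∀ r, 0 < r → HasDerivAt φ (g r / ∫ t in r₀..r₁, g t) r := by
    intro r hrp
    rw [funext hφ]
    refine HasDerivAt.div_const ?_ _
    refine intervalIntegral.integral_hasDerivAt_right (hii r₀ r hr₀ hrp) ?_
      (hgc.continuousAt (Ioi_mem_nhds hrp))
    exact hgc.stronglyMeasurableAtFilter isOpen_Ioi r hrp
  refine ⟨hI, hd, ?_, ?_, ?_, ?_⟩
  · rw [contDiffOn_infty_iff_deriv_of_isOpen isOpen_Ioi]
    refine ⟨fun r h => (hd r h).differentiableAt.differentiableWithinAt, ?_⟩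
    exact (hg.div_const (∫ t in r₀..r₁, g t)).congr (fun r h => (hd r h).deriv)
  · rw [hφ]; simp
  · rw [hφ]; exact div_self hI.ne'
  · intro r h0 h1
    have e1 := hp r₀ r hr₀ h0
    have e2 := hp r r₁ (hr₀.trans h0) h1
    rw [hφ, div_lt_one hI]
    refine ⟨by positivity, ?_⟩
    rw [← intervalIntegral.integral_add_adjacent_intervals (hii r₀ r hr₀ (hr₀.trans h0))
      (hii r r₁ (hr₀.trans h0) (hr₀.trans hr))]
    linarith

lemma rsa_g (m q : ℝ) : ContDiffOn ℝ (⊤ : ℕ∞)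
    (fun t : ℝ => (Real.exp (t ^ 2 / 2) * t ^ m) ^ q) (Ioi 0) ∧
    ∀ t : ℝ, 0 < t → 0 < (Real.exp (t ^ 2 / 2) * t ^ m) ^ q := by
  constructor
  · intro t ht
    have ht' : (0:ℝ) < t := ht
    apply ContDiffAt.contDiffWithinAt
    apply ContDiffAt.rpow_const_of_ne
    · apply ContDiffAt.mul
      · fun_prop
      · exact contDiffAt_id.rpow_const_of_ne ht'.ne'
    · positivity
  · intro t ht
    positivity

variable {n : ℕ}

lemma rsa_grad {φ : ℝ → ℝ} {d : ℝ} {x : EuclideanSpace ℝ (Fin n)} (hx : x ≠ 0)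
    (hφ : HasDerivAt φ d ‖x‖) : gradient (fun y => φ ‖y‖) x = (d / ‖x‖) • x := by
  have hx' : 0 < ‖x‖ := norm_pos_iff.mpr hx
  have h1 : HasFDerivAt (fun y : EuclideanSpace ℝ (Fin n) => ‖y‖ ^ 2) (2 • innerSL ℝ x) x :=
    (hasStrictFDerivAt_norm_sq x).hasFDerivAt
  have h2 := h1.sqrt (by positivity)
  simp only [Real.sqrt_sq (norm_nonneg _)] at h2
  have h3 := hφ.comp_hasFDerivAt x h2
  apply HasGradientAt.gradient
  rw [hasGradientAt_iff_hasFDerivAt]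
  refine HasFDerivAt.congr_fderiv h3 ?_
  ext y
  rw [InnerProductSpace.toDual_apply_apply, real_inner_smul_left]
  simp only [ContinuousLinearMap.smul_apply, innerSL_apply_apply, smul_eq_mul, nsmul_eq_mul,
    Nat.cast_ofNat]
  field_simp

/-- model field -/
lemma rsa_field (C : ℝ) {x : EuclideanSpace ℝ (Fin n)} (hx : x ≠ 0) :
    ContDiffAt ℝ 1 (fun y : EuclideanSpace ℝ (Fin n) =>
      (C * (‖y‖ ^ 2) ^ (-(n : ℝ) / 2)) • y) x ∧
    (∑ i : Fin n, (fderiv ℝ (fun y : EuclideanSpace ℝ (Fin n) =>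
      (C * (‖y‖ ^ 2) ^ (-(n : ℝ) / 2)) • y) x (EuclideanSpace.single i 1)) i) = 0 := by
  have hx' : 0 < ‖x‖ := norm_pos_iff.mpr hx
  have hx2 : ‖x‖ ^ 2 ≠ 0 := by positivity
  constructor
  · refine ContDiffAt.smul (f := fun y : EuclideanSpace ℝ (Fin n) =>
      C * (‖y‖ ^ 2) ^ (-(n : ℝ) / 2)) (g := fun y => y) ?_ contDiffAt_id
    apply contDiffAt_const.mul
    exact (contDiff_norm_sq ℝ).contDiffAt.rpow_const_of_ne hx2
  · have h1 : HasFDerivAt (fun y : EuclideanSpace ℝ (Fin n) => ‖y‖ ^ 2) (2 • innerSL ℝ x) x :=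
      (hasStrictFDerivAt_norm_sq x).hasFDerivAt
    have h2 := (h1.rpow_const (p := -(n : ℝ) / 2) (Or.inl hx2)).const_mul C
    have h3 := h2.smul (hasFDerivAt_id x)
    rw [HasFDerivAt.fderiv (f := fun y : EuclideanSpace ℝ (Fin n) =>
      (C * (‖y‖ ^ 2) ^ (-(n : ℝ) / 2)) • y) h3]
    have hs : ∑ i : Fin n, x i * x i = ‖x‖ ^ 2 := by
      rw [EuclideanSpace.real_norm_sq_eq]
      simp [sq]
    have hr : (‖x‖ ^ 2) ^ (-(n : ℝ) / 2) = (‖x‖ ^ 2) ^ (-(n : ℝ) / 2 - 1) * ‖x‖ ^ 2 := by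
      rw [← Real.rpow_add_one hx2]; ring_nf
    have : ∀ i : Fin n, (((C * (‖x‖ ^ 2) ^ (-(n : ℝ) / 2)) • (ContinuousLinearMap.id ℝ
        (EuclideanSpace ℝ (Fin n))) + (C • (-(n : ℝ) / 2 * (‖x‖ ^ 2) ^ (-(n : ℝ) / 2 - 1)) •
        2 • innerSL ℝ x).smulRight (id x)) (EuclideanSpace.single i (1:ℝ))) i =
        C * (‖x‖ ^ 2) ^ (-(n : ℝ) / 2) + C * ((-(n : ℝ)) * (‖x‖ ^ 2) ^ (-(n : ℝ) / 2 - 1))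
          * (x i * x i) := by
      intro i
      have hi : ⟪x, EuclideanSpace.single i (1:ℝ)⟫ = x i := by
        rw [EuclideanSpace.inner_single_right]; simp
      simp [hi]
      ring
    refine (Finset.sum_congr rfl (fun i _ => this i)).trans ?_
    rw [Finset.sum_add_distrib, ← Finset.mul_sum, ← Finset.mul_sum, hs, hr]
    simp
    ring

lemma rsa_alg {p I r e : ℝ} (m : ℝ) (hp : 1 < p) (hI : 0 < I) (hr : 0 < r) (he : 0 < e) :
    e⁻¹ * ((e * r ^ (1 - m)) ^ (1 / (p - 1)) / I) ^ (p - 2) *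
      (((e * r ^ (1 - m)) ^ (1 / (p - 1)) / I) / r) = (I ^ (p - 1))⁻¹ * (r ^ 2) ^ (-m / 2) := by
  have h1 : (r ^ 2) ^ (-m / 2) = r ^ (1 - m) / r := by
    rw [← Real.rpow_natCast r 2, ← Real.rpow_mul hr.le, ← Real.rpow_sub_one hr.ne']
    congr 1
    push_cast
    ring
  set b := (e * r ^ (1 - m)) ^ (1 / (p - 1)) with hb
  have hb0 : 0 < b := by positivity
  have h2 : (b / I) ^ (p - 2) * (b / I) = (e * r ^ (1 - m)) / I ^ (p - 1) := by
    rw [rsa_rpow_mul hp (by positivity), Real.div_rpow hb0.le hI.le, hb,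
      ← Real.rpow_mul (by positivity), one_div, inv_mul_cancel₀ (by linarith), Real.rpow_one]
  calc _ = e⁻¹ * ((b / I) ^ (p - 2) * (b / I)) / r := by ring
    _ = _ := by rw [h2, h1]; field_simp

lemma rsa_unique {p : ℝ} (hp : 1 < p) {A : Set (EuclideanSpace ℝ (Fin n))} (hA : IsOpen A)
    (hAc : IsCompact (closure A)) {x₁ : EuclideanSpace ℝ (Fin n)} (hx₁ : x₁ ∉ A)
    {u w : EuclideanSpace ℝ (Fin n) → ℝ} {ρ : EuclideanSpace ℝ (Fin n) → ℝ}
    (hρ : Continuous ρ) (hρ0 : ∀ x, 0 < ρ x)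
    (hu : ContDiffOn ℝ 1 u A) (hw : ContDiffOn ℝ 1 w A)
    (huc : ContinuousOn u (closure A)) (hwc : ContinuousOn w (closure A))
    (hb : ∀ x ∈ closure A, x ∉ A → w x = u x)
    (hwu : ∀ ψ, IsTestFun n A ψ →
      ∫ x, ⟪ρ x • (‖gradient u x‖ ^ (p - 2) • gradient u x), gradient ψ x⟫ = 0)
    (hww : ∀ ψ, IsTestFun n A ψ →
      ∫ x, ⟪ρ x • (‖gradient w x‖ ^ (p - 2) • gradient w x), gradient ψ x⟫ = 0) :
    ∀ x ∈ A, w x = u x := by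
  have hgc : ∀ f : EuclideanSpace ℝ (Fin n) → ℝ, ContDiffOn ℝ 1 f A → ContinuousOn
      (fun x => ρ x • (‖gradient f x‖ ^ (p - 2) • gradient f x)) A := by
    intro f hf
    have h1 : ContinuousOn (gradient f) A :=
      (LinearIsometryEquiv.continuous _).comp_continuousOn
        (hf.continuousOn_fderiv_of_isOpen hA le_rfl)
    exact hρ.continuousOn.smul ((rsa_cont hp).comp_continuousOn h1)
  intro x₀ hx₀
  by_contra hne
  have hne' : 0 < |w x₀ - u x₀| := abs_pos.mpr (sub_ne_zero.mpr hne)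
  set ε := |w x₀ - u x₀| / 2 with hε
  have hε0 : 0 < ε := by positivity
  obtain ⟨η, η', hη1, hηd, hη'0, hηz, hηz'⟩ := rsa_eta ε hε0
  classical
  set Ψ : EuclideanSpace ℝ (Fin n) → ℝ := fun x => if x ∈ A then η (w x - u x) else 0 with hΨ
  set K : Set (EuclideanSpace ℝ (Fin n)) := closure A ∩ {x | ε ≤ |w x - u x|} with hKdef
  have hKcl : IsClosed K := by
    have : ContinuousOn (fun x => |w x - u x|) (closure A) := (hwc.sub huc).abs
    exact this.preimage_isClosed_of_isClosed isClosed_closure isClosed_Ici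
  have hKc : IsCompact K := hAc.of_isClosed_subset hKcl inter_subset_left
  have hKA : K ⊆ A := by
    rintro x ⟨hx, hx2⟩
    by_contra h
    rw [mem_ofPred_eq, hb x hx h, sub_self, abs_zero] at hx2
    linarith
  have hΨK : ∀ x, x ∉ K → Ψ x = 0 := by
    intro x hx
    by_cases hxA : x ∈ A
    · simp only [hΨ, if_pos hxA]
      apply hηz
      by_contra! h
      exact hx ⟨subset_closure hxA, h⟩
    · simp only [hΨ, if_neg hxA]
  have hsK : tsupport Ψ ⊆ K := by
    refine closure_minimal ?_ hKcl
    intro x hx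
    by_contra h
    exact hx (hΨK x h)
  have hΨc : HasCompactSupport Ψ := hKc.of_isClosed_subset (isClosed_tsupport _) hsK
  have hΨA : ∀ x ∈ A, Ψ =ᶠ[𝓝 x] fun x => η (w x - u x) := by
    intro x hx
    filter_upwards [hA.mem_nhds hx] with y hy
    simp only [hΨ, if_pos hy]
  have hΨ1 : ContDiff ℝ 1 Ψ := by
    rw [contDiff_iff_contDiffAt]
    intro x
    by_cases hx : x ∈ A
    · refine ContDiffAt.congr_of_eventuallyEq ?_ (hΨA x hx)
      exact hη1.contDiffAt.comp x ((hw.contDiffAt (hA.mem_nhds hx)).sub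
        (hu.contDiffAt (hA.mem_nhds hx)))
    · refine (contDiffAt_const (c := (0:ℝ))).congr_of_eventuallyEq ?_
      filter_upwards [hKcl.isOpen_compl.mem_nhds (fun h => hx (hKA h))] with y hy
      exact hΨK y hy
  have hgrad : ∀ x ∈ A, gradient Ψ x = η' (w x - u x) • (gradient w x - gradient u x) := by
    intro x hx
    have h1 := ((hw.contDiffAt (hA.mem_nhds hx)).differentiableAt one_ne_zero).hasFDerivAt
    have h2 := ((hu.contDiffAt (hA.mem_nhds hx)).differentiableAt one_ne_zero).hasFDerivAt
    have h3 := (hηd (w x - u x)).comp_hasFDerivAt x (h1.sub h2)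
    have h4 := h3.congr_of_eventuallyEq (hΨA x hx)
    unfold gradient
    rw [h4.fderiv]
    simp
  have hsA := hsK.trans hKA
  have e1 := rsa_weak_C1 hA (hgc w hw) hww hΨ1 hΨc hsA
  have e2 := rsa_weak_C1 hA (hgc u hu) hwu hΨ1 hΨc hsA
  set H : EuclideanSpace ℝ (Fin n) → ℝ := fun x =>
    ⟪ρ x • (‖gradient w x‖ ^ (p - 2) • gradient w x)
      - ρ x • (‖gradient u x‖ ^ (p - 2) • gradient u x), gradient Ψ x⟫ with hH
  have hHc : Continuous H := rsa_inner_cont hA ((hgc w hw).sub (hgc u hu)) hΨ1 hsA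
  have hHs : HasCompactSupport H := rsa_inner_supp hΨc
  have hHA : ∀ x ∈ A, H x = ρ x * (η' (w x - u x) *
      ⟪‖gradient w x‖ ^ (p - 2) • gradient w x - ‖gradient u x‖ ^ (p - 2) • gradient u x,
        gradient w x - gradient u x⟫) := by
    intro x hx
    simp only [hH]
    rw [hgrad x hx, ← smul_sub, real_inner_smul_left, real_inner_smul_right]
  have hH0 : 0 ≤ H := by
    intro x
    by_cases hx : x ∈ A
    · rw [hHA x hx]
      exact mul_nonneg (hρ0 x).le (mul_nonneg (hη'0 _) (rsa_mono hp _ _).1)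
    · simp only [hH]
      rw [rsa_gradient_supp (fun h => hx (hsA h)), inner_zero_right]
      rfl
  have hHi : ∫ x, H x = 0 := by
    simp only [hH, inner_sub_left]
    rw [integral_sub, e1, e2, sub_zero]
    · exact (rsa_inner_cont hA (hgc w hw) hΨ1 hsA).integrable_of_hasCompactSupport
        (rsa_inner_supp hΨc)
    · exact (rsa_inner_cont hA (hgc u hu) hΨ1 hsA).integrable_of_hasCompactSupport
        (rsa_inner_supp hΨc)
  have hHz : ∀ x, H x = 0 := by
    intro x
    by_contra h
    have := hHc.integral_pos_of_hasCompactSupport_nonneg_nonzero (μ := volume) hHs hH0 h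
    linarith
  have hg0 : ∀ x, gradient Ψ x = 0 := by
    intro x
    by_cases hx : x ∈ A
    · have h1 := hHz x
      rw [hHA x hx] at h1
      rw [hgrad x hx]
      rcases mul_eq_zero.mp h1 with h | h
      · exact absurd h (hρ0 x).ne'
      · rcases mul_eq_zero.mp h with h | h
        · rw [h, zero_smul]
        · rw [(rsa_mono hp _ _).2 h, sub_self, smul_zero]
    · exact rsa_gradient_supp (fun h => hx (hsA h))
  have hf0 : ∀ x, fderiv ℝ Ψ x = 0 := by
    intro x
    have := hg0 x
    unfold gradient at this
    simpa using this
  have hconst := is_const_of_fderiv_eq_zero (hΨ1.differentiable one_ne_zero) hf0 x₀ x₁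
  simp only [hΨ, if_pos hx₀, if_neg hx₁] at hconst
  have := hηz' _ hconst
  linarith

end Helpers3
/-- **The explicit radial solution on an annulus** (Proposition 3.4 of the paper): the
radially symmetric function `u(x) = φ(‖x‖)`, with `φ` given by a quotient of explicit
integrals, is the unique solution of the weighted `p`-Laplace capacity problem on the
annulus `{r₀ < ‖x‖ < r₁}`; it is smooth, takes values strictly between `0` and `1`, has
gradient bounded away from zero, and satisfies the equation
`div(e^{-‖x‖²/2} ‖∇u‖^{p-2} ∇u) = 0` pointwise. -/
theorem radial_solution_annulus
    (n : ℕ) (hn : 2 ≤ n) (p : ℝ) (hp : 1 < p)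
    (r₀ r₁ : ℝ) (hr₀ : 0 < r₀) (hr : r₀ < r₁)
    (φ : ℝ → ℝ)
    (hφ : ∀ r : ℝ, φ r =
      (∫ t in r₀..r, (Real.exp (t ^ 2 / 2) * t ^ (1 - (n : ℝ))) ^ (1 / (p - 1))) /
      (∫ t in r₀..r₁, (Real.exp (t ^ 2 / 2) * t ^ (1 - (n : ℝ))) ^ (1 / (p - 1))))
    (u : EuclideanSpace ℝ (Fin n) → ℝ) (hu : ∀ x, u x = φ ‖x‖)
    (A : Set (EuclideanSpace ℝ (Fin n)))
    (hA : A = {x : EuclideanSpace ℝ (Fin n) | r₀ < ‖x‖ ∧ ‖x‖ < r₁}) :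
    -- (i) smoothness and the pointwise equation in the open annulus
    ContDiffOn ℝ (⊤ : ℕ∞) u A ∧
    (∀ x ∈ A,
      (∑ i : Fin n, (fderiv ℝ
          (fun y => (Real.exp (-‖y‖ ^ 2 / 2) * ‖gradient u y‖ ^ (p - 2)) • gradient u y) x
          (EuclideanSpace.single i 1)) i) = 0) ∧
    -- (ii) boundary values
    (∀ x : EuclideanSpace ℝ (Fin n), ‖x‖ = r₀ → u x = 0) ∧
    (∀ x : EuclideanSpace ℝ (Fin n), ‖x‖ = r₁ → u x = 1) ∧
    -- (iii) `0 < u < 1` in the annulus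
    (∀ x ∈ A, 0 < u x ∧ u x < 1) ∧
    -- (iv) the gradient is bounded away from zero
    (∃ c : ℝ, 0 < c ∧ ∀ x ∈ A, c ≤ ‖gradient u x‖) ∧
    -- (v) uniqueness among `C¹(cl A)` weak solutions with the same boundary values
    (∀ w : EuclideanSpace ℝ (Fin n) → ℝ, ContDiffOn ℝ 1 w (closure A) →
      (∀ x : EuclideanSpace ℝ (Fin n), ‖x‖ = r₀ → w x = 0) →
      (∀ x : EuclideanSpace ℝ (Fin n), ‖x‖ = r₁ → w x = 1) →
      (∀ ψ : EuclideanSpace ℝ (Fin n) → ℝ, IsTestFun n A ψ →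
        ∫ x in A,
          Real.exp (-‖x‖ ^ 2 / 2) * (‖gradient w x‖ ^ (p - 2) * ⟪gradient w x, gradient ψ x⟫)
          = 0) →
      ∀ x ∈ closure A, w x = u x) := by
  have hn0 : (0 : ℝ) < n := by positivity
  obtain ⟨hgs, hgp⟩ := rsa_g (1 - (n : ℝ)) (1 / (p - 1))
  obtain ⟨hI, hφd, hφs, hφ0, hφ1, hφm⟩ := rsa_phi hr₀ hr hgs hgp hφ
  set I := ∫ t in r₀..r₁, (Real.exp (t ^ 2 / 2) * t ^ (1 - (n : ℝ))) ^ (1 / (p - 1)) with hIdef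
  have huf : u = fun x => φ ‖x‖ := funext hu
  have hAo : IsOpen A := by
    rw [hA]
    exact (isOpen_lt continuous_const continuous_norm).inter
      (isOpen_lt continuous_norm continuous_const)
  have hAn : ∀ x ∈ A, r₀ < ‖x‖ ∧ ‖x‖ < r₁ := by
    intro x hx; rw [hA] at hx; exact hx
  have hcl : ∀ x ∈ closure A, r₀ ≤ ‖x‖ ∧ ‖x‖ ≤ r₁ := by
    have hc : IsClosed {x : EuclideanSpace ℝ (Fin n) | r₀ ≤ ‖x‖ ∧ ‖x‖ ≤ r₁} :=
      (isClosed_le continuous_const continuous_norm).inter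
        (isClosed_le continuous_norm continuous_const)
    exact closure_minimal (fun x hx => ⟨(hAn x hx).1.le, (hAn x hx).2.le⟩) hc
  have hne : ∀ x ∈ closure A, x ≠ 0 := by
    intro x hx
    exact norm_pos_iff.mp (hr₀.trans_le (hcl x hx).1)
  have hus : ∀ x : EuclideanSpace ℝ (Fin n), x ≠ 0 → ContDiffAt ℝ (⊤ : ℕ∞) u x := by
    intro x hx
    rw [huf]
    exact (hφs.contDiffAt (Ioi_mem_nhds (norm_pos_iff.mpr hx))).comp x (contDiffAt_norm ℝ hx)
  have hgr : ∀ x : EuclideanSpace ℝ (Fin n), x ≠ 0 → gradient u x =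
      ((Real.exp (‖x‖ ^ 2 / 2) * ‖x‖ ^ (1 - (n : ℝ))) ^ (1 / (p - 1)) / I / ‖x‖) • x := by
    intro x hx
    rw [huf]
    exact rsa_grad hx (hφd _ (norm_pos_iff.mpr hx))
  have hgn : ∀ x : EuclideanSpace ℝ (Fin n), x ≠ 0 → ‖gradient u x‖ =
      (Real.exp (‖x‖ ^ 2 / 2) * ‖x‖ ^ (1 - (n : ℝ))) ^ (1 / (p - 1)) / I := by
    intro x hx
    have h1 : 0 < ‖x‖ := norm_pos_iff.mpr hx
    have h2 := hgp ‖x‖ h1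
    rw [hgr x hx, norm_smul, Real.norm_of_nonneg (by positivity)]
    field_simp
  have hfield : ∀ x : EuclideanSpace ℝ (Fin n), x ≠ 0 →
      (Real.exp (-‖x‖ ^ 2 / 2) * ‖gradient u x‖ ^ (p - 2)) • gradient u x =
      ((I ^ (p - 1))⁻¹ * (‖x‖ ^ 2) ^ (-(n : ℝ) / 2)) • x := by
    intro x hx
    rw [hgn x hx, hgr x hx, smul_smul, ← rsa_alg (n : ℝ) hp hI (norm_pos_iff.mpr hx)
      (Real.exp_pos (‖x‖ ^ 2 / 2)), ← Real.exp_neg, neg_div]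
  have hfe : ∀ x ∈ A, (fun y => (Real.exp (-‖y‖ ^ 2 / 2) * ‖gradient u y‖ ^ (p - 2)) •
      gradient u y) =ᶠ[𝓝 x] fun y => ((I ^ (p - 1))⁻¹ * (‖y‖ ^ 2) ^ (-(n : ℝ) / 2)) • y := by
    intro x hx
    filter_upwards [hAo.mem_nhds hx] with y hy
    exact hfield y (hne y (subset_closure hy))
  have hdiv : ∀ x ∈ A,
      (∑ i : Fin n, (fderiv ℝ
          (fun y => (Real.exp (-‖y‖ ^ 2 / 2) * ‖gradient u y‖ ^ (p - 2)) • gradient u y) x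
          (EuclideanSpace.single i 1)) i) = 0 := by
    intro x hx
    rw [(hfe x hx).fderiv_eq]
    exact (rsa_field _ (hne x (subset_closure hx))).2
  refine ⟨fun x hx => (hus x (hne x (subset_closure hx))).contDiffWithinAt, hdiv, ?_, ?_, ?_,
    ?_, ?_⟩
  · intro x hx; rw [hu, hx, hφ0]
  · intro x hx; rw [hu, hx, hφ1]
  · intro x hx; rw [hu]; exact hφm _ (hAn x hx).1 (hAn x hx).2
  · obtain ⟨t, ht, hmin⟩ := isCompact_Icc.exists_isMinOn (nonempty_Icc.mpr hr.le)
      (hgs.continuousOn.mono (fun t (ht : t ∈ Icc r₀ r₁) => hr₀.trans_le ht.1))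
    refine ⟨_, div_pos (hgp t (hr₀.trans_le ht.1)) hI, fun x hx => ?_⟩
    rw [hgn x (hne x (subset_closure hx))]
    exact div_le_div_of_nonneg_right (hmin ⟨(hAn x hx).1.le, (hAn x hx).2.le⟩) hI.le
  · intro w hw hw0 hw1 hweak
    have hbd : ∀ x ∈ closure A, x ∉ A → w x = u x := by
      intro x hx hxA
      have h1 := hcl x hx
      rw [hA] at hxA
      rcases h1.1.eq_or_lt with h | h
      · rw [hw0 x h.symm, hu, ← h, hφ0]
      · rcases h1.2.eq_or_lt with h' | h'
        · rw [hw1 x h', hu, h', hφ1]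
        · exact absurd ⟨h, h'⟩ hxA
    have hcpt : IsCompact (closure A) := by
      refine (isCompact_closedBall (0 : EuclideanSpace ℝ (Fin n)) r₁).of_isClosed_subset
        isClosed_closure ?_
      intro x hx
      simpa using (hcl x hx).2
    have h0A : (0 : EuclideanSpace ℝ (Fin n)) ∉ A := by
      intro h
      have := (hAn 0 h).1
      rw [norm_zero] at this
      linarith
    have main := rsa_unique hp hAo hcpt h0A (u := u) (w := w)
      (ρ := fun x => Real.exp (-‖x‖ ^ 2 / 2)) (by fun_prop) (fun x => Real.exp_pos _)
      (fun x hx => ((hus x (hne x (subset_closure hx))).of_le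
        (by exact_mod_cast le_top)).contDiffWithinAt)
      (hw.mono subset_closure)
      (fun x hx => (hus x (hne x hx)).continuousAt.continuousWithinAt)
      hw.continuousOn hbd ?_ ?_
    · intro x hx
      by_cases hxA : x ∈ A
      · exact main x hxA
      · exact hbd x hx hxA
    · rintro ψ ⟨hψ, hψc, hψA⟩
      simp_rw [smul_smul]
      refine rsa_weak_of_div hAo ?_ hdiv (hψ.of_le (by exact_mod_cast le_top)) hψc hψA
      intro x hx
      exact ((rsa_field _ (hne x (subset_closure hx))).1.congr_of_eventuallyEq
        (hfe x hx)).contDiffWithinAt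
    · intro ψ hψ
      have h := hweak ψ hψ
      rw [setIntegral_eq_integral_of_forall_compl_eq_zero] at h
      · simpa only [real_inner_smul_left] using h
      · intro x hx
        rw [rsa_gradient_supp (fun h => hx (hψ.2.2 h)), inner_zero_right]
        simp
end

section
/- (Hopf lemma for the weighted p-Laplacian.) Let n ≥ 2, p > 1, and let Ω ⊂ ℝⁿ be a bounded open set with boundary of class C². Let u ∈ C¹(cl Ω) satisfy u > 0 in Ω, u = 0 on ∂Ω, and suppose u is a weak supersolution: for every nonnegative φ ∈ C_c^∞(Ω), ∫_Ω e^{-‖x‖²/2} ‖∇u‖^{p-2} ⟨∇u, ∇φ⟩ dx ≥ 0. Then for every x₀ ∈ ∂Ω and every unit vector ν that is an outward normal direction at x₀ (i.e. there exists r > 0 with the open ball B(x₀ − rν, r) ⊆ Ω), the directional derivative of u at x₀ in the direction ν is strictly negative. -/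
open MeasureTheory Real Set Metric Bornology
open scoped RealInnerProductSpace Pointwise NNReal Topology

theorem hopf_pvec_mono {E : Type*} [NormedAddCommGroup E] [InnerProductSpace ℝ E]
    (p : ℝ) (hp : 1 < p) (a b : E) (hab : a ≠ b) :
    0 < ⟪‖a‖ ^ (p - 2) • a - ‖b‖ ^ (p - 2) • b, a - b⟫ := by
  have key : ∀ s : ℝ, 0 ≤ s → s ^ (p - 2) * s = s ^ (p - 1) := by
    intro s hs
    rcases hs.eq_or_lt with h | h
    · rw [← h, mul_zero, Real.zero_rpow (by linarith)]
    · rw [← Real.rpow_add_one h.ne']; congr 1; ring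
  have hA := norm_nonneg a
  have hB := norm_nonneg b
  have ex : ⟪‖a‖ ^ (p - 2) • a - ‖b‖ ^ (p - 2) • b, a - b⟫ =
      ‖a‖ ^ (p - 2) * ‖a‖ ^ 2 + ‖b‖ ^ (p - 2) * ‖b‖ ^ 2
        - (‖a‖ ^ (p - 2) + ‖b‖ ^ (p - 2)) * ⟪a, b⟫ := by
    rw [inner_sub_left, inner_sub_right, inner_sub_right]
    simp only [real_inner_smul_left, real_inner_self_eq_norm_sq, real_inner_comm a b]
    ring
  by_cases h : ‖a‖ = ‖b‖
  · have ha : 0 < ‖a‖ := by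
      rcases hA.eq_or_lt with h0 | h0
      · exfalso; apply hab
        rw [norm_eq_zero.1 h0.symm, norm_eq_zero.1 (h ▸ h0.symm : ‖b‖ = 0)]
      · exact h0
    rw [← h, ← smul_sub, real_inner_smul_left, real_inner_self_eq_norm_sq]
    have := norm_pos_iff.2 (sub_ne_zero.2 hab)
    positivity
  · rw [ex]
    have hi := real_inner_le_norm a b
    have h1 : 0 ≤ ‖a‖ ^ (p - 2) + ‖b‖ ^ (p - 2) := by positivity
    have h2 := mul_le_mul_of_nonneg_left hi h1
    have h3 : 0 < (‖a‖ ^ (p - 1) - ‖b‖ ^ (p - 1)) * (‖a‖ - ‖b‖) := by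
      rcases lt_or_gt_of_ne h with h | h
      · have := Real.rpow_lt_rpow hA h (by linarith : 0 < p - 1)
        exact mul_pos_of_neg_of_neg (by linarith) (by linarith)
      · have := Real.rpow_lt_rpow hB h (by linarith : 0 < p - 1)
        exact mul_pos (by linarith) (by linarith)
    rw [← key _ hA, ← key _ hB] at h3
    nlinarith

theorem hopf_pvec_cont {E : Type*} [NormedAddCommGroup E] [InnerProductSpace ℝ E]
    (p : ℝ) (hp : 1 < p) : Continuous (fun a : E => ‖a‖ ^ (p - 2) • a) := by
  rw [continuous_iff_continuousAt]
  intro a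
  by_cases ha : a = 0
  · subst ha
    have : Filter.Tendsto (fun a : E => ‖‖a‖ ^ (p - 2) • a‖) (𝓝 0) (𝓝 0) := by
      have h1 : (fun a : E => ‖‖a‖ ^ (p - 2) • a‖) = fun a : E => ‖a‖ ^ (p - 1) := by
        ext a
        rw [norm_smul, Real.norm_of_nonneg (by positivity)]
        rcases (norm_nonneg a).eq_or_lt with h | h
        · rw [← h, mul_zero, Real.zero_rpow (by linarith)]
        · rw [← Real.rpow_add_one h.ne']; congr 1; ring
      rw [h1]
      have h2 : ContinuousAt (fun a : E => ‖a‖ ^ (p - 1)) 0 :=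
        continuous_norm.continuousAt.rpow_const (Or.inr (by linarith))
      have h3 := h2.tendsto
      simpa [Real.zero_rpow (by linarith : p - 1 ≠ 0)] using h3
    rw [ContinuousAt, smul_zero]
    exact tendsto_zero_iff_norm_tendsto_zero.2 this
  · exact (continuous_norm.continuousAt.rpow_const (Or.inl (norm_ne_zero_iff.2 ha))).smul
      continuousAt_id

theorem hopf_norm_rpow {E : Type*} [NormedAddCommGroup E] [InnerProductSpace ℝ E]
    (c : ℝ) (x y : E) (h : x ≠ y) :
    HasFDerivAt (fun x => ‖x - y‖ ^ c) ((c * ‖x - y‖ ^ (c - 2)) • innerSL ℝ (x - y)) x := by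
  have hz : 0 < ‖x - y‖ := norm_pos_iff.2 (sub_ne_zero.2 h)
  have h1 := (((hasFDerivAt_id x).sub_const y).norm_sq).rpow_const (p := c / 2)
    (Or.inl (by simpa using hz.ne'))
  have e : (fun x => ‖x - y‖ ^ c) = fun x => (‖id x - y‖ ^ 2) ^ (c / 2) := by
    ext x
    rw [← Real.rpow_natCast, ← Real.rpow_mul (norm_nonneg _)]; simp; congr 1; ring
  rw [e]
  convert! h1 using 1
  have e2 : (‖id x - y‖ ^ 2) ^ (c / 2 - 1) = ‖x - y‖ ^ (c - 2) := by
    rw [← Real.rpow_natCast, ← Real.rpow_mul (norm_nonneg _)]; simp; congr 1; ring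
  rw [e2]
  ext w
  simp
  ring

theorem hopf_euler {n : ℕ} (ψ : EuclideanSpace ℝ (Fin n) → ℝ) (hψ : ContDiff ℝ 1 ψ)
    (hc : HasCompactSupport ψ) (y : EuclideanSpace ℝ (Fin n)) :
    ∫ x, fderiv ℝ ψ x (x - y) = - n * ∫ x, ψ x := by
  have hd : Continuous (fderiv ℝ ψ) := hψ.continuous_fderiv (by norm_num)
  have hdc : HasCompactSupport (fderiv ℝ ψ) := hc.fderiv ℝ
  have hcont : ∀ i : Fin n, Continuous (fun x : EuclideanSpace ℝ (Fin n) =>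
      (x i - y i) * fderiv ℝ ψ x (EuclideanSpace.single i 1)) := by
    intro i
    fun_prop
  have hint : ∀ i : Fin n, Integrable (fun x : EuclideanSpace ℝ (Fin n) =>
      (x i - y i) * fderiv ℝ ψ x (EuclideanSpace.single i 1)) := by
    intro i
    refine (hcont i).integrable_of_hasCompactSupport ?_
    refine hdc.mono ?_
    intro x hx
    contrapose! hx
    simp only [Function.mem_support, not_not] at hx ⊢
    simp [hx]
  have e : ∀ x, fderiv ℝ ψ x (x - y) =
      ∑ i, (x i - y i) * fderiv ℝ ψ x (EuclideanSpace.single i 1) := by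
    intro x
    have : x - y = ∑ i, (x i - y i) • (EuclideanSpace.single i (1:ℝ)) := by
      have := (EuclideanSpace.basisFun (Fin n) ℝ).sum_repr (x - y)
      rw [← this]
      simp
    conv_lhs => rw [this]
    simp
  simp_rw [e]
  rw [integral_finsetSum _ (fun i _ => hint i)]
  have h1 : ∀ i : Fin n, ∫ x : EuclideanSpace ℝ (Fin n),
      (x i - y i) * fderiv ℝ ψ x (EuclideanSpace.single i 1) = - ∫ x, ψ x := by
    intro i
    have hf : ∀ x : EuclideanSpace ℝ (Fin n), HasFDerivAt (𝕜 := ℝ)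
        (fun x : EuclideanSpace ℝ (Fin n) => x i - y i)
        (EuclideanSpace.proj i : EuclideanSpace ℝ (Fin n) →L[ℝ] ℝ) x := by
      intro x
      exact ((EuclideanSpace.proj i : EuclideanSpace ℝ (Fin n) →L[ℝ] ℝ).hasFDerivAt).sub_const (y i)
    have hfd : ∀ x : EuclideanSpace ℝ (Fin n), fderiv ℝ
        (fun x : EuclideanSpace ℝ (Fin n) => x i - y i) x (EuclideanSpace.single i 1) = 1 := by
      intro x
      rw [(hf x).fderiv]
      simp
    rw [integral_mul_fderiv_eq_neg_fderiv_mul_of_integrable]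
    · simp_rw [hfd, one_mul]
    · simp_rw [hfd, one_mul]
      exact hψ.continuous.integrable_of_hasCompactSupport hc
    · exact hint i
    · refine Continuous.integrable_of_hasCompactSupport ?_ hc.mul_left
      have := hψ.continuous
      fun_prop
    · intro x _; exact (hf x).differentiableAt
    · intro x _; exact (hψ.differentiable (by norm_num)) x
  simp_rw [h1]
  simp

theorem hopf_cont {E : Type*} [NormedAddCommGroup E] [InnerProductSpace ℝ E]
    {Ω : Set E} (hΩ : IsOpen Ω) {W G : E → E} (hW : ContinuousOn W Ω) (hG : Continuous G)
    {K : Set E} (hK : IsClosed K) (hKΩ : K ⊆ Ω) (h0 : ∀ x, x ∉ K → G x = 0) :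
    Continuous (fun x => ⟪W x, G x⟫) := by
  rw [continuous_iff_continuousAt]
  intro x
  by_cases hx : x ∈ Ω
  · exact (hW.continuousAt (hΩ.mem_nhds hx)).inner hG.continuousAt
  · have : (fun x => ⟪W x, G x⟫) =ᶠ[𝓝 x] fun _ => (0:ℝ) := by
      filter_upwards [hK.isOpen_compl.mem_nhds (fun h => hx (hKΩ h))] with z hz
      simp [h0 z hz]
    exact continuousAt_const.congr this.symm

theorem hopf_grad_zero {E : Type*} [NormedAddCommGroup E] [InnerProductSpace ℝ E] [CompleteSpace E]
    {f : E → ℝ} {K : Set E} (hK : tsupport f ⊆ K) :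
    ∀ x, x ∉ K → gradient f x = 0 := by
  intro x hx
  have : fderiv ℝ f x = 0 := by
    by_contra h
    exact hx (hK (support_fderiv_subset ℝ h))
  simp [gradient, this]

theorem hopf_grad_cont {E : Type*} [NormedAddCommGroup E] [InnerProductSpace ℝ E] [CompleteSpace E]
    {f : E → ℝ} (hf : ContDiff ℝ 1 f) : Continuous (gradient f) :=
  (InnerProductSpace.toDual ℝ E).symm.continuous.comp (hf.continuous_fderiv (by norm_num))

theorem hopf_moll {n : ℕ} {Ω : Set (EuclideanSpace ℝ (Fin n))} (hΩ : IsOpen Ω)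
    {W : EuclideanSpace ℝ (Fin n) → EuclideanSpace ℝ (Fin n)} (hW : ContinuousOn W Ω)
    (H : ∀ φ : EuclideanSpace ℝ (Fin n) → ℝ, IsTestFun n Ω φ → (∀ x, 0 ≤ φ x) →
      0 ≤ ∫ x in Ω, ⟪W x, gradient φ x⟫)
    {φ : EuclideanSpace ℝ (Fin n) → ℝ} (hφ : ContDiff ℝ 1 φ) (hc : HasCompactSupport φ)
    (hs : tsupport φ ⊆ Ω) (hpos : ∀ x, 0 ≤ φ x) :
    0 ≤ ∫ x, ⟪W x, gradient φ x⟫ := by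
  obtain ⟨δ, hδ, hKΩ⟩ := IsCompact.exists_cthickening_subset_open hc hΩ hs
  have hKc : IsCompact (cthickening δ (tsupport φ)) := IsCompact.cthickening hc
  have hφK : tsupport φ ⊆ cthickening δ (tsupport φ) := self_subset_cthickening _
  generalize hKdef : cthickening δ (tsupport φ) = K at *
  obtain ⟨C, hC⟩ := hKc.exists_bound_of_continuousOn (hW.mono hKΩ)
  have hd : Continuous (fderiv ℝ φ) := hφ.continuous_fderiv (by norm_num)
  have hdc : HasCompactSupport (fderiv ℝ φ) := hc.fderiv ℝ
  have hu : UniformContinuous (fderiv ℝ φ) := hd.uniformContinuous_of_tendsto_cocompact hdc.is_zero_at_infty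
  have main : ∀ ε : ℝ, 0 < ε → - (C * ε * volume.real K) ≤ ∫ x, ⟪W x, gradient φ x⟫ := by
    intro ε hε
    obtain ⟨η, hη, hηε⟩ := Metric.uniformContinuous_iff.1 hu ε hε
    have hm : 0 < min δ η := lt_min hδ hη
    let b : ContDiffBump (0 : EuclideanSpace ℝ (Fin n)) :=
      ⟨min δ η / 2, min δ η, by linarith, by linarith⟩
    let g : EuclideanSpace ℝ (Fin n) → ℝ :=
      convolution (b.normed volume) φ (ContinuousLinearMap.lsmul ℝ ℝ) volume
    have hbc : HasCompactSupport (b.normed volume) := b.hasCompactSupport_normed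
    have hgs : ContDiff ℝ (⊤ : ℕ∞) g :=
      hbc.contDiff_convolution_left _ b.contDiff_normed hφ.continuous.locallyIntegrable
    have hgK : tsupport g ⊆ K := by
      refine closure_minimal ?_ hKc.isClosed
      intro x hx
      have h1 := support_convolution_subset (ContinuousLinearMap.lsmul ℝ ℝ) hx
      obtain ⟨s, hs1, t, ht1, rfl⟩ := h1
      rw [b.support_normed_eq, mem_ball_zero_iff] at hs1
      rw [← hKdef]
      refine mem_cthickening_of_dist_le (s + t) t δ _ (subset_tsupport _ ht1) ?_
      simp only [dist_eq_norm, add_sub_cancel_right]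
      exact hs1.le.trans (min_le_left _ _)
    have hgpos : ∀ x, 0 ≤ g x := by
      intro x
      refine integral_nonneg ?_
      intro t
      simp only [ContinuousLinearMap.lsmul_apply, smul_eq_mul, Pi.zero_apply]
      exact mul_nonneg (b.nonneg_normed _) (hpos _)
    have hgc : HasCompactSupport g := hKc.of_isClosed_subset (isClosed_tsupport _) hgK
    have hgd : ∀ x, ‖fderiv ℝ g x - fderiv ℝ φ x‖ ≤ ε := by
      intro x
      have h1 := hc.hasFDerivAt_convolution_right (ContinuousLinearMap.lsmul ℝ ℝ)
        (μ := volume) (f := b.normed volume)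
        (b.continuous_normed.locallyIntegrable) hφ x
      have h2 : fderiv ℝ g x = convolution (b.normed volume) (fderiv ℝ φ)
        (ContinuousLinearMap.lsmul ℝ ℝ) volume x := by
        rw [h1.fderiv]
        rfl
      rw [h2, ← dist_eq_norm]
      refine b.dist_normed_convolution_le hd.aestronglyMeasurable ?_
      intro z hz
      refine (hηε ?_).le
      exact (mem_ball.1 hz).trans_le (min_le_right _ _)
    have hgg : ∀ x, ‖gradient g x - gradient φ x‖ ≤ ε := by
      intro x
      rw [gradient, gradient, ← map_sub, LinearIsometryEquiv.norm_map]
      exact hgd x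
    have hT := H g ⟨hgs, hgc, hgK.trans hKΩ⟩ hgpos
    have hg1 : ContDiff ℝ 1 g := hgs.of_le (by exact_mod_cast le_top)
    have hz1 := hopf_grad_zero hgK
    have hz2 := hopf_grad_zero hφK
    have c1 := hopf_cont hΩ hW (hopf_grad_cont hg1) hKc.isClosed hKΩ hz1
    have c2 := hopf_cont hΩ hW (hopf_grad_cont hφ) hKc.isClosed hKΩ hz2
    have i1 : Integrable (fun x => ⟪W x, gradient g x⟫) :=
      c1.integrable_of_hasCompactSupport
        (HasCompactSupport.intro hKc (fun x hx => by simp [hz1 x hx]))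
    have i2 : Integrable (fun x => ⟪W x, gradient φ x⟫) :=
      c2.integrable_of_hasCompactSupport
        (HasCompactSupport.intro hKc (fun x hx => by simp [hz2 x hx]))
    rw [setIntegral_eq_integral_of_forall_compl_eq_zero
      (fun x hx => by simp [hz1 x (fun h => hx (hKΩ h))])] at hT
    have hdiff : ‖∫ x in K, (⟪W x, gradient g x⟫ - ⟪W x, gradient φ x⟫)‖
        ≤ C * ε * volume.real K := by
      refine norm_setIntegral_le_of_norm_le_const hKc.measure_lt_top ?_
      intro x hx
      rw [← inner_sub_right]
      refine (norm_inner_le_norm _ _).trans ?_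
      exact mul_le_mul (hC x hx) (hgg x) (norm_nonneg _) ((norm_nonneg _).trans (hC x hx))
    rw [setIntegral_eq_integral_of_forall_compl_eq_zero
      (fun x hx => by simp [hz1 x hx, hz2 x hx]), integral_sub i1 i2, Real.norm_eq_abs] at hdiff
    have := (abs_le.1 hdiff).2
    linarith
  by_contra hneg
  push Not at hneg
  set I := ∫ x, ⟪W x, gradient φ x⟫ with hI
  have hD : 0 < |C * volume.real K| + 1 := by positivity
  have h1 := main (-I / 2 / (|C * volume.real K| + 1)) (by apply div_pos <;> linarith)
  have h2 : C * (-I / 2 / (|C * volume.real K| + 1)) * volume.real K =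
    (C * volume.real K / (|C * volume.real K| + 1)) * (-I / 2) := by ring
  have h3 : C * volume.real K / (|C * volume.real K| + 1) ≤ 1 := by
    rw [div_le_one hD]; linarith [le_abs_self (C * volume.real K)]
  nlinarith

theorem hopf_barrier {n : ℕ} (y : EuclideanSpace ℝ (Fin n)) (γ c : ℝ) (hc0 : 0 ≤ c)
    {φ : EuclideanSpace ℝ (Fin n) → ℝ} (hφ : ContDiff ℝ 1 φ) (hc : HasCompactSupport φ)
    (hy : y ∉ tsupport φ) (hpos : ∀ x, 0 ≤ φ x)
    (hγ : ∀ x ∈ tsupport φ, n - ⟪x, x - y⟫ - γ ≤ 0) :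
    ∫ x, ⟪Real.exp (-‖x‖ ^ 2 / 2) • (-(c * ‖x - y‖ ^ (-γ)) • (x - y)), gradient φ x⟫ ≤ 0 := by
  let w : EuclideanSpace ℝ (Fin n) → ℝ :=
    fun x => Real.exp (-‖x‖ ^ 2 / 2) * (c * ‖x - y‖ ^ (-γ))
  let ψ : EuclideanSpace ℝ (Fin n) → ℝ := fun x => w x * φ x
  have hwpos : ∀ x, 0 ≤ w x := fun x => by positivity
  have hsub : tsupport ψ ⊆ tsupport φ := tsupport_mul_subset_right
  have hψc : HasCompactSupport ψ := hc.mul_left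
  have hwc : ∀ x, x ≠ y → ContDiffAt ℝ 1 w x := by
    intro x hx
    have h1 : ‖x - y‖ ≠ 0 := norm_ne_zero_iff.2 (sub_ne_zero.2 hx)
    have h2 : ContDiffAt ℝ 1 (fun x : EuclideanSpace ℝ (Fin n) => ‖x - y‖ ^ (-γ)) x :=
      ((contDiffAt_id.sub contDiffAt_const).norm ℝ (sub_ne_zero.2 hx)).rpow_const_of_ne h1
    have h3 : ContDiffAt ℝ 1 (fun x : EuclideanSpace ℝ (Fin n) => Real.exp (-‖x‖ ^ 2 / 2)) x :=
      (((contDiff_norm_sq ℝ).neg.div_const 2).exp).contDiffAt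
    exact h3.mul (contDiffAt_const.mul h2)
  have hψ : ContDiff ℝ 1 ψ := by
    rw [contDiff_iff_contDiffAt]
    intro x
    by_cases hx : x = y
    · subst hx
      have : ψ =ᶠ[𝓝 x] fun _ => 0 := by
        filter_upwards [(isClosed_tsupport φ).isOpen_compl.mem_nhds hy] with z hz
        simp [ψ, image_eq_zero_of_notMem_tsupport hz]
      exact contDiffAt_const.congr_of_eventuallyEq this
    · exact (hwc x hx).mul hφ.contDiffAt
  have hwd : ∀ x, x ≠ y → fderiv ℝ w x (x - y) = w x * (-⟪x, x - y⟫ - γ) := by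
    intro x hx
    have h1 := hopf_norm_rpow (-γ) x y hx
    have h2 : HasFDerivAt (fun x : EuclideanSpace ℝ (Fin n) => Real.exp (-‖x‖ ^ 2 / 2)) _ x :=
      (((hasFDerivAt_id x).norm_sq.neg).mul_const (2⁻¹ : ℝ)).exp
    have h3 := h2.mul (h1.const_mul c)
    have h4 : HasFDerivAt w _ x := h3
    rw [h4.fderiv]
    have hz : 0 < ‖x - y‖ := norm_pos_iff.2 (sub_ne_zero.2 hx)
    have e : ‖x - y‖ ^ (-γ) = ‖x - y‖ ^ (-γ - 2) * ‖x - y‖ ^ 2 := by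
      rw [← Real.rpow_natCast, ← Real.rpow_add hz]; congr 1; norm_num
    have e3 : ‖x - y‖ ^ 2 = ⟪x, x - y⟫ - ⟪y, x - y⟫ := by
      rw [← inner_sub_left, real_inner_self_eq_norm_sq]
    simp [w, -norm_neg]
    rw [e, e3]
    ring_nf
  have hpt : ∀ x, ⟪Real.exp (-‖x‖ ^ 2 / 2) • (-(c * ‖x - y‖ ^ (-γ)) • (x - y)), gradient φ x⟫ =
      - fderiv ℝ ψ x (x - y) + ψ x * (-⟪x, x - y⟫ - γ) := by
    intro x
    by_cases hx : x ∈ tsupport φ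
    · have hxy : x ≠ y := fun h => hy (h ▸ hx)
      have h1 : fderiv ℝ ψ x = w x • fderiv ℝ φ x + φ x • fderiv ℝ w x :=
        fderiv_fun_mul ((hwc x hxy).differentiableAt (by norm_num))
          (hφ.differentiable (by norm_num) x)
      rw [h1, real_inner_smul_left, real_inner_smul_left, real_inner_comm, inner_gradient_left]
      simp only [add_apply, smul_apply, smul_eq_mul,
        hwd x hxy]
      simp only [ψ, w]
      ring
    · have h1 : gradient φ x = 0 := hopf_grad_zero subset_rfl x hx
      have h2 : fderiv ℝ ψ x = 0 := by
        by_contra h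
        exact hx (hsub (support_fderiv_subset ℝ h))
      simp [h1, h2, ψ, image_eq_zero_of_notMem_tsupport hx]
  simp_rw [hpt]
  have hd : Continuous (fderiv ℝ ψ) := hψ.continuous_fderiv (by norm_num)
  have hψcont := hψ.continuous
  have i1 : Integrable (fun x => - fderiv ℝ ψ x (x - y)) := by
    refine Continuous.integrable_of_hasCompactSupport (by fun_prop)
      (HasCompactSupport.intro (hψc.fderiv ℝ) (fun x hx => ?_))
    simp [image_eq_zero_of_notMem_tsupport hx]
  have i2 : Integrable (fun x => ψ x * (-⟪x, x - y⟫ - γ)) := by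
    refine Continuous.integrable_of_hasCompactSupport (by fun_prop) hψc.mul_right
  have i3 : Integrable ψ := hψcont.integrable_of_hasCompactSupport hψc
  rw [integral_add i1 i2, integral_neg, hopf_euler ψ hψ hψc y, neg_mul, neg_neg,
    ← integral_const_mul, ← integral_add (i3.const_mul _) i2]
  refine integral_nonpos ?_
  intro x
  by_cases hx : x ∈ tsupport φ
  · have h1 := hγ x hx
    have h2 : 0 ≤ ψ x := mul_nonneg (hwpos x) (hpos x)
    simp only [Pi.zero_apply]
    nlinarith
  · simp [ψ, image_eq_zero_of_notMem_tsupport hx]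

theorem hopf_sq_deriv (t : ℝ) : HasDerivAt (fun t : ℝ => (max t 0) ^ 2) (2 * max t 0) t := by
  rcases lt_trichotomy t 0 with h | h | h
  · rw [max_eq_right h.le, mul_zero]
    refine (hasDerivAt_const t (0:ℝ)).congr_of_eventuallyEq ?_
    filter_upwards [Iio_mem_nhds h] with s hs
    simp [max_eq_right (le_of_lt (mem_Iio.1 hs))]
  · subst h
    rw [hasDerivAt_iff_isLittleO]
    have h1 : (fun x : ℝ => x ^ 2) =o[𝓝 0] fun x : ℝ => x := by
      simpa using Asymptotics.isLittleO_pow_pow (𝕜 := ℝ) (m := 1) (n := 2) (by norm_num)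
    refine Asymptotics.IsBigO.trans_isLittleO ?_ (by simpa using h1)
    refine Asymptotics.IsBigO.of_bound 1 (Filter.Eventually.of_forall ?_)
    intro x
    rcases le_total x 0 with h | h <;> simp [h]
    positivity
  · rw [max_eq_left h.le]
    have := hasDerivAt_pow 2 t
    simp only [Nat.cast_ofNat, Nat.add_one_sub_one, pow_one] at this
    refine this.congr_of_eventuallyEq ?_
    filter_upwards [Ioi_mem_nhds h] with s hs
    simp [max_eq_left (le_of_lt (mem_Ioi.1 hs))]

theorem hopf_sq_contDiff : ContDiff ℝ 1 (fun t : ℝ => (max t 0) ^ 2) := by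
  rw [contDiff_one_iff_deriv]
  refine ⟨fun t => (hopf_sq_deriv t).differentiableAt, ?_⟩
  have : deriv (fun t : ℝ => (max t 0) ^ 2) = fun t => 2 * max t 0 := by
    ext t; exact (hopf_sq_deriv t).deriv
  rw [this]
  fun_prop

theorem hopf_compare {n : ℕ} (p : ℝ) (hp : 1 < p) {A K : Set (EuclideanSpace ℝ (Fin n))}
    (hA : IsOpen A) (hK : IsCompact K) (hKA : K ⊆ A)
    (u v : EuclideanSpace ℝ (Fin n) → ℝ) (hu : ContDiffOn ℝ 1 u A) (hv : ContDiffOn ℝ 1 v A)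
    (δ : ℝ) (hδ : ∀ x ∈ A, x ∉ K → v x - u x ≤ δ) (y : EuclideanSpace ℝ (Fin n)) (hy : y ∉ K)
    (Hu : ∀ φ : EuclideanSpace ℝ (Fin n) → ℝ, ContDiff ℝ 1 φ → HasCompactSupport φ →
      tsupport φ ⊆ A → (∀ x, 0 ≤ φ x) →
      0 ≤ ∫ x, ⟪Real.exp (-‖x‖ ^ 2 / 2) • (‖gradient u x‖ ^ (p - 2) • gradient u x),
        gradient φ x⟫)
    (Hv : ∀ φ : EuclideanSpace ℝ (Fin n) → ℝ, ContDiff ℝ 1 φ → HasCompactSupport φ →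
      tsupport φ ⊆ A → (∀ x, 0 ≤ φ x) →
      ∫ x, ⟪Real.exp (-‖x‖ ^ 2 / 2) • (‖gradient v x‖ ^ (p - 2) • gradient v x),
        gradient φ x⟫ ≤ 0) :
    ∀ x ∈ A, v x - u x ≤ δ := by
  classical
  let φ : EuclideanSpace ℝ (Fin n) → ℝ :=
    fun x => if x ∈ A then (max (v x - u x - δ) 0) ^ 2 else 0
  have hφ0 : ∀ x, x ∉ K → φ x = 0 := by
    intro x hx
    by_cases hxA : x ∈ A
    · have := hδ x hxA hx
      simp [φ, max_eq_right (by linarith : v x - u x - δ ≤ 0)]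
    · simp [φ, hxA]
  have hφA : ∀ x ∈ A, φ =ᶠ[𝓝 x] fun x => (max (v x - u x - δ) 0) ^ 2 := by
    intro x hx
    filter_upwards [hA.mem_nhds hx] with z hz
    simp [φ, hz]
  have hua : ∀ x ∈ A, ContDiffAt ℝ 1 u x := fun x hx => hu.contDiffAt (hA.mem_nhds hx)
  have hva : ∀ x ∈ A, ContDiffAt ℝ 1 v x := fun x hx => hv.contDiffAt (hA.mem_nhds hx)
  have hφ : ContDiff ℝ 1 φ := by
    rw [contDiff_iff_contDiffAt]
    intro x
    by_cases hx : x ∈ A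
    · refine ContDiffAt.congr_of_eventuallyEq ?_ (hφA x hx)
      exact hopf_sq_contDiff.contDiffAt.comp x
        (((hva x hx).sub (hua x hx)).sub contDiffAt_const)
    · have : φ =ᶠ[𝓝 x] fun _ => 0 := by
        filter_upwards [hK.isClosed.isOpen_compl.mem_nhds (fun h => hx (hKA h))] with z hz
        exact hφ0 z hz
      exact contDiffAt_const.congr_of_eventuallyEq this
  have hsK : tsupport φ ⊆ K := by
    refine closure_minimal ?_ hK.isClosed
    intro x hx
    by_contra h
    exact hx (hφ0 x h)
  have hφc : HasCompactSupport φ := HasCompactSupport.intro hK hφ0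
  have hφpos : ∀ x, 0 ≤ φ x := by
    intro x
    simp only [φ]
    split_ifs <;> positivity
  have h1 := Hu φ hφ hφc (hsK.trans hKA) hφpos
  have h2 := Hv φ hφ hφc (hsK.trans hKA) hφpos
  have hgφ : ∀ x ∈ A, gradient φ x = (2 * max (v x - u x - δ) 0) • (gradient v x - gradient u x) := by
    intro x hx
    have a1 := ((hva x hx).differentiableAt (by norm_num)).hasFDerivAt
    have a2 := ((hua x hx).differentiableAt (by norm_num)).hasFDerivAt
    have a3 := (hopf_sq_deriv (v x - u x - δ)).comp_hasFDerivAt x ((a1.sub a2).sub_const δ)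
    have a4 := (a3.congr_of_eventuallyEq (hφA x hx)).fderiv
    rw [gradient, gradient, gradient, a4]
    simp
  have hgc : ∀ f : EuclideanSpace ℝ (Fin n) → ℝ, ContDiffOn ℝ 1 f A →
      ContinuousOn (fun x => Real.exp (-‖x‖ ^ 2 / 2) • (‖gradient f x‖ ^ (p - 2) • gradient f x)) A := by
    intro f hf
    have b1 : ContinuousOn (gradient f) A :=
      (InnerProductSpace.toDual ℝ _).symm.continuous.comp_continuousOn
        (hf.continuousOn_fderiv_of_isOpen hA (by norm_num))
    have b2 := (hopf_pvec_cont p hp).comp_continuousOn b1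
    have b3 : Continuous (fun x : EuclideanSpace ℝ (Fin n) => Real.exp (-‖x‖ ^ 2 / 2)) := by
      fun_prop
    exact b3.continuousOn.smul b2
  have hz := hopf_grad_zero hsK
  have c1 := hopf_cont hA (hgc u hu) (hopf_grad_cont hφ) hK.isClosed hKA hz
  have c2 := hopf_cont hA (hgc v hv) (hopf_grad_cont hφ) hK.isClosed hKA hz
  have s1 : HasCompactSupport (fun x => ⟪Real.exp (-‖x‖ ^ 2 / 2) •
      (‖gradient u x‖ ^ (p - 2) • gradient u x), gradient φ x⟫) :=
    HasCompactSupport.intro hK (fun x hx => by simp [hz x hx])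
  have s2 : HasCompactSupport (fun x => ⟪Real.exp (-‖x‖ ^ 2 / 2) •
      (‖gradient v x‖ ^ (p - 2) • gradient v x), gradient φ x⟫) :=
    HasCompactSupport.intro hK (fun x hx => by simp [hz x hx])
  have h3 := integral_sub (c2.integrable_of_hasCompactSupport s2 (μ := volume))
    (c1.integrable_of_hasCompactSupport s1)
  have hF : ∀ x ∈ A, ⟪Real.exp (-‖x‖ ^ 2 / 2) • (‖gradient v x‖ ^ (p - 2) • gradient v x),
        gradient φ x⟫ - ⟪Real.exp (-‖x‖ ^ 2 / 2) • (‖gradient u x‖ ^ (p - 2) • gradient u x),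
        gradient φ x⟫ = Real.exp (-‖x‖ ^ 2 / 2) * (2 * max (v x - u x - δ) 0) *
        ⟪‖gradient v x‖ ^ (p - 2) • gradient v x - ‖gradient u x‖ ^ (p - 2) • gradient u x,
          gradient v x - gradient u x⟫ := by
    intro x hx
    rw [← inner_sub_left, ← smul_sub, hgφ x hx, real_inner_smul_left, real_inner_smul_right]
    ring
  have hgz : ∀ x, gradient φ x = 0 := by
    by_contra hcon
    push Not at hcon
    obtain ⟨x, hx⟩ := hcon
    have hxA : x ∈ A := by
      by_contra h
      exact hx (hz x (fun h' => h (hKA h')))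
    have hpos := (c2.sub c1).integral_pos_of_hasCompactSupport_nonneg_nonzero (μ := volume)
      (x := x) (s2.sub s1) ?_ ?_
    · simp only [Pi.sub_apply] at hpos
      linarith
    · intro z
      simp only [Pi.zero_apply, Pi.sub_apply]
      by_cases hzA : z ∈ A
      · rw [hF z hzA]
        by_cases he : gradient v z = gradient u z
        · simp [he]
        · have := hopf_pvec_mono p hp _ _ he
          positivity
      · simp [hz z (fun h' => hzA (hKA h'))]
    · simp only [Pi.sub_apply]
      rw [hF x hxA]
      rw [hgφ x hxA] at hx
      have hx1 := smul_ne_zero_iff.1 hx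
      have := hopf_pvec_mono p hp _ _ (sub_ne_zero.1 hx1.2)
      exact mul_ne_zero (mul_ne_zero (Real.exp_pos _).ne' hx1.1) this.ne'
  have hfz : ∀ x, fderiv ℝ φ x = 0 := by
    intro x
    rw [← toDual_gradient, hgz x, map_zero]
  intro x hx
  have h5 := is_const_of_fderiv_eq_zero (hφ.differentiable (by norm_num)) hfz x y
  rw [hφ0 y hy] at h5
  simp only [φ, hx, if_true] at h5
  have h6 := pow_eq_zero_iff (two_ne_zero) |>.1 h5
  have := le_max_left (v x - u x - δ) 0
  linarith

/-- **Hopf boundary-point lemma for the weighted `p`-Laplacian** (Proposition 3.5 of the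
paper): if `u ∈ C¹(cl Ω)` is positive in `Ω`, vanishes on `∂Ω`, and is a weak
supersolution of the weighted `p`-Laplace equation, then at every boundary point the
derivative of `u` in any outward normal direction is strictly negative. -/
theorem hopf_lemma_weighted_p_laplace
    (n : ℕ) (hn : 2 ≤ n) (p : ℝ) (hp : 1 < p)
    (Ω : Set (EuclideanSpace ℝ (Fin n)))
    (hΩo : IsOpen Ω) (hΩb : IsBounded Ω) (hΩ2 : HasC2Boundary n Ω)
    (u : EuclideanSpace ℝ (Fin n) → ℝ)
    (hu1 : ContDiffOn ℝ 1 u (closure Ω))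
    (hupos : ∀ x ∈ Ω, 0 < u x)
    (hub : ∀ x ∈ frontier Ω, u x = 0)
    (hsuper : ∀ φ : EuclideanSpace ℝ (Fin n) → ℝ, IsTestFun n Ω φ → (∀ x, 0 ≤ φ x) →
      0 ≤ ∫ x in Ω,
        Real.exp (-‖x‖ ^ 2 / 2) * (‖gradient u x‖ ^ (p - 2) * ⟪gradient u x, gradient φ x⟫)) :
    ∀ x₀ ∈ frontier Ω, ∀ ν : EuclideanSpace ℝ (Fin n), ‖ν‖ = 1 →
      (∃ r : ℝ, 0 < r ∧ Metric.ball (x₀ - r • ν) r ⊆ Ω) →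
      fderivWithin ℝ u (closure Ω) x₀ ν < 0 := by
  intro x₀ hx₀ ν hν ⟨r, hr, hball⟩
  set y := x₀ - r • ν with hy
  have hclos : closedBall y r ⊆ closure Ω := by
    rw [← closure_ball y hr.ne']
    exact closure_mono hball
  have hunn : ∀ x ∈ closure Ω, 0 ≤ u x := by
    intro x hx
    rw [closure_eq_self_union_frontier] at hx
    rcases hx with h | h
    · exact (hupos x h).le
    · exact (hub x h).ge
  have hucont : ContinuousOn u (closure Ω) := hu1.continuousOn
  have huΩ : ContDiffOn ℝ 1 u Ω := hu1.mono subset_closure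
  -- minimum on the inner ball
  have hsubr : closedBall y (r / 2) ⊆ ball y r := closedBall_subset_ball (by linarith)
  obtain ⟨x₁, hx₁, hmin⟩ := (isCompact_closedBall y (r / 2)).exists_isMinOn
    ⟨y, mem_closedBall_self (by linarith)⟩ (huΩ.continuousOn.mono (hsubr.trans hball))
  have hm : 0 < u x₁ := hupos _ (hball (hsubr hx₁))
  -- constants
  obtain ⟨M, hM⟩ : ∃ M : ℝ, M = (‖y‖ + r) * r := ⟨_, rfl⟩
  have hM0 : 0 ≤ M := by rw [hM]; positivity
  obtain ⟨b, hb⟩ : ∃ b : ℝ, b = (n + M) / (p - 1) := ⟨_, rfl⟩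
  have hp1 : 0 < p - 1 := by linarith
  have hn0 : (2:ℝ) ≤ n := by exact_mod_cast hn
  have hb0 : 0 < b := by rw [hb]; apply div_pos <;> linarith
  have hbp : b * (p - 1) = n + M := by rw [hb]; field_simp
  obtain ⟨D, hD⟩ : ∃ D : ℝ, D = (r / 2) ^ (-b) - r ^ (-b) := ⟨_, rfl⟩
  have hD0 : 0 < D := by
    rw [hD]
    have := Real.rpow_lt_rpow_of_neg (by linarith : 0 < r / 2) (by linarith : r / 2 < r)
      (by linarith : -b < 0)
    linarith
  obtain ⟨ε, hε⟩ : ∃ ε : ℝ, ε = u x₁ / D := ⟨_, rfl⟩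
  have hε0 : 0 < ε := by rw [hε]; positivity
  have hεD : ε * D = u x₁ := by rw [hε]; field_simp
  obtain ⟨γ, hγ⟩ : ∃ γ : ℝ, γ = (b + 1) * (p - 1) + 1 := ⟨_, rfl⟩
  let v : EuclideanSpace ℝ (Fin n) → ℝ := fun x => ε * (‖x - y‖ ^ (-b) - r ^ (-b))
  have hvd : ∀ x, x ≠ y → HasGradientAt v (-(ε * b * ‖x - y‖ ^ (-b - 2)) • (x - y)) x := by
    intro x hx
    rw [hasGradientAt_iff_hasFDerivAt]
    have h1 := ((hopf_norm_rpow (-b) x y hx).sub_const (r ^ (-b))).const_mul ε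
    convert! h1 using 1
    ext w
    simp [inner_sub_left]
    ring
  have hvp : ∀ x, x ≠ y → ‖gradient v x‖ ^ (p - 2) • gradient v x =
      -((ε * b) ^ (p - 2) * (ε * b) * ‖x - y‖ ^ (-γ)) • (x - y) := by
    intro x hx
    have hz : 0 < ‖x - y‖ := norm_pos_iff.2 (sub_ne_zero.2 hx)
    rw [(hvd x hx).gradient, norm_smul, norm_neg, Real.norm_of_nonneg (by positivity), smul_smul]
    congr 1
    have e1 : ε * b * ‖x - y‖ ^ (-b - 2) * ‖x - y‖ = ε * b * ‖x - y‖ ^ (-b - 1) := by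
      rw [mul_assoc, ← Real.rpow_add_one hz.ne']; congr 2; ring
    rw [e1, Real.mul_rpow (by positivity) (by positivity), ← Real.rpow_mul hz.le]
    have e2 : ‖x - y‖ ^ (-γ) = ‖x - y‖ ^ ((-b - 1) * (p - 2)) * ‖x - y‖ ^ (-b - 2) := by
      rw [← Real.rpow_add hz]; congr 1; rw [hγ]; ring
    rw [e2]; ring
  -- annulus
  let A : Set (EuclideanSpace ℝ (Fin n)) := ball y r \ closedBall y (r / 2)
  have hAo : IsOpen A := isOpen_ball.sdiff isClosed_closedBall
  have hAΩ : A ⊆ Ω := diff_subset.trans hball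
  have hyA : y ∉ A := fun h => h.2 (mem_closedBall_self (by linarith))
  have hvC : ∀ x, x ≠ y → ContDiffAt ℝ 1 v x := by
    intro x hx
    have h1 : ‖x - y‖ ≠ 0 := norm_ne_zero_iff.2 (sub_ne_zero.2 hx)
    have h2 : ContDiffAt ℝ 1 (fun x : EuclideanSpace ℝ (Fin n) => ‖x - y‖ ^ (-b)) x :=
      ((contDiffAt_id.sub contDiffAt_const).norm ℝ (sub_ne_zero.2 hx)).rpow_const_of_ne h1
    exact contDiffAt_const.mul (h2.sub contDiffAt_const)
  have hvA : ContDiffOn ℝ 1 v A := by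
    intro x hx
    exact (hvC x (fun h => hyA (h ▸ hx))).contDiffWithinAt
  have hWc : ContinuousOn (fun x => Real.exp (-‖x‖ ^ 2 / 2) •
      (‖gradient u x‖ ^ (p - 2) • gradient u x)) Ω := by
    have b1 : ContinuousOn (gradient u) Ω :=
      (InnerProductSpace.toDual ℝ _).symm.continuous.comp_continuousOn
        (huΩ.continuousOn_fderiv_of_isOpen hΩo (by norm_num))
    have b2 := (hopf_pvec_cont p hp).comp_continuousOn b1
    have b3 : Continuous (fun x : EuclideanSpace ℝ (Fin n) => Real.exp (-‖x‖ ^ 2 / 2)) := by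
      fun_prop
    exact b3.continuousOn.smul b2
  have hcmp : ∀ x ∈ A, v x ≤ u x := by
    intro x hx
    refine le_of_forall_pos_le_add ?_
    intro δ hδ
    let cA : Set (EuclideanSpace ℝ (Fin n)) := closedBall y r \ ball y (r / 2)
    have hcA : IsClosed cA := isClosed_closedBall.sdiff isOpen_ball
    have hcAc : IsCompact cA := (isCompact_closedBall y r).diff isOpen_ball
    have hycA : y ∉ cA := fun h => h.2 (mem_ball_self (by linarith))
    have hfc : ContinuousOn (fun x => v x - u x) cA := by
      refine ContinuousOn.sub ?_ (hucont.mono (diff_subset.trans hclos))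
      intro z hz
      exact (hvC z (fun h => hycA (h ▸ hz))).continuousAt.continuousWithinAt
    have hKcl : IsClosed (cA ∩ (fun x => v x - u x) ⁻¹' Ici δ) :=
      hfc.preimage_isClosed_of_isClosed hcA isClosed_Ici
    have hKc : IsCompact (cA ∩ (fun x => v x - u x) ⁻¹' Ici δ) :=
      hcAc.of_isClosed_subset hKcl inter_subset_left
    have := hopf_compare p hp hAo hKc (K := cA ∩ (fun x => v x - u x) ⁻¹' Ici δ) ?_ u v
      (huΩ.mono hAΩ) hvA δ ?_ y (fun h => hycA h.1) ?_ ?_ x hx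
    · linarith
    · intro z hz
      obtain ⟨hz1, hz2⟩ := hz
      have hz3 : δ ≤ v z - u z := hz2
      have hz4 : ‖z - y‖ ≤ r := mem_closedBall_iff_norm.1 hz1.1
      have hz5 : r / 2 ≤ ‖z - y‖ := by
        have := hz1.2
        rw [mem_ball_iff_norm] at this
        linarith
      refine ⟨?_, ?_⟩
      · rw [mem_ball_iff_norm]
        rcases hz4.eq_or_lt with h | h
        · exfalso
          have h1 : v z = 0 := by simp only [v]; rw [h]; ring
          have h2 := hunn z (hclos hz1.1)
          linarith
        · exact h
      · rw [mem_closedBall_iff_norm]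
        intro h
        have h0 : ‖z - y‖ = r / 2 := le_antisymm h hz5
        have h1 : v z = u x₁ := by
          simp only [v]; rw [h0, ← hεD, hD]
        have h2 : u x₁ ≤ u z := hmin (mem_closedBall_iff_norm.2 h)
        linarith
    · intro z hzA hzK
      by_contra h
      push Not at h
      refine hzK ⟨⟨ball_subset_closedBall hzA.1, fun h' => hzA.2 (ball_subset_closedBall h')⟩, ?_⟩
      exact h.le
    · intro φ hφ hφc hφA hφ0
      refine hopf_moll hΩo hWc ?_ hφ hφc (hφA.trans hAΩ) hφ0
      intro φ hφ hφ0
      simpa only [real_inner_smul_left] using hsuper φ hφ hφ0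
    · intro φ hφ hφc hφA hφ0
      have hb := hopf_barrier y γ ((ε * b) ^ (p - 2) * (ε * b)) (by positivity) hφ hφc
        (fun h => hyA (hφA h)) hφ0 ?_
      · convert! hb using 2
        ext z
        by_cases hz : z = y
        · rw [hopf_grad_zero hφA z (hz ▸ hyA)]; simp
        · rw [hvp z hz]
      · intro z hz
        have h1 : ‖z - y‖ ≤ r := (mem_ball_iff_norm.1 (hφA hz).1).le
        have h2 : ‖z‖ ≤ ‖y‖ + r := by
          have := norm_add_le y (z - y)
          rw [add_sub_cancel] at this
          linarith
        have h3 : -⟪z, z - y⟫ ≤ M := by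
          have := abs_real_inner_le_norm z (z - y)
          have h4 : ‖z‖ * ‖z - y‖ ≤ M := by
            rw [hM]
            exact mul_le_mul h2 h1 (norm_nonneg _) (by positivity)
          have := (abs_le.1 this).1
          linarith
        rw [hγ]
        nlinarith
  -- derivative at the boundary point
  set L := fderivWithin ℝ u (closure Ω) x₀ with hL
  have hx₀c : x₀ ∈ closure Ω := frontier_subset_closure hx₀
  have hLd : HasFDerivWithinAt u L (closure Ω) x₀ :=
    (hu1.differentiableOn (by norm_num) x₀ hx₀c).hasFDerivWithinAt
  have hpos : ∀ t ∈ Ioo 0 (r / 2), x₀ - t • ν ∈ A ∧ ‖x₀ - t • ν - y‖ = r - t := by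
    intro t ht
    have h1 : x₀ - t • ν - y = (r - t) • ν := by rw [hy, sub_smul]; abel
    have h2 : ‖x₀ - t • ν - y‖ = r - t := by
      rw [h1, norm_smul, hν, mul_one, Real.norm_of_nonneg (by linarith [ht.2])]
    refine ⟨⟨?_, ?_⟩, h2⟩
    · rw [mem_ball_iff_norm, h2]; linarith [ht.1]
    · rw [mem_closedBall_iff_norm, h2]; linarith [ht.2]
  have hg : HasDerivWithinAt (fun t : ℝ => x₀ - t • ν) (-((1:ℝ) • ν)) (Ioo 0 (r / 2)) 0 :=
    (((hasDerivAt_id (0:ℝ)).smul_const ν).const_sub x₀).hasDerivWithinAt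
  have hLd' : HasFDerivWithinAt u L (closure Ω) (x₀ - (0:ℝ) • ν) := by simpa using hLd
  have hd1 : HasDerivWithinAt (fun t : ℝ => u (x₀ - t • ν)) (L (-((1:ℝ) • ν))) (Ioo 0 (r / 2)) 0 :=
    hLd'.comp_hasDerivWithinAt (0:ℝ) hg (fun t ht => subset_closure (hAΩ (hpos t ht).1))
  have hd2 : HasDerivWithinAt (fun t : ℝ => ε * ((r - t) ^ (-b) - r ^ (-b)))
      (ε * (-1 * (-b) * (r - 0) ^ (-b - 1))) (Ioo 0 (r / 2)) 0 :=
    (((((hasDerivAt_id (0:ℝ)).const_sub r).rpow_const (p := -b)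
      (Or.inl (by simpa using hr.ne'))).sub_const (r ^ (-b))).const_mul ε).hasDerivWithinAt
  have hd3 := hd1.sub hd2
  rw [hasDerivWithinAt_iff_tendsto_slope' (by simp)] at hd3
  have hne : (𝓝[Ioo 0 (r / 2)] (0:ℝ)).NeBot := by
    rw [nhdsWithin_Ioo_eq_nhdsGT (by linarith)]; infer_instance
  have hge := ge_of_tendsto (b := (0:ℝ)) hd3 (by
    filter_upwards [self_mem_nhdsWithin] with t ht
    obtain ⟨h1, h2⟩ := hpos t ht
    have h3 := hcmp _ h1
    simp only [v] at h3
    rw [h2] at h3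
    have h4 := hub x₀ hx₀
    simp only [slope_def_field, Pi.sub_apply, zero_smul, sub_zero, h4, sub_self, mul_zero]
    exact div_nonneg (by linarith) ht.1.le)
  have hrb : 0 < ε * (b * r ^ (-b - 1)) := by positivity
  simp only [one_smul, map_neg, sub_zero] at hge
  nlinarith
end
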